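/- Let Assumption (H) hold with E[‖A‖_HS^8] < ∞. Then W_2(F,G) ≤ ‖K‖_op^{1/2}·((√3/(6√2))·(2√6+3√2+2+√d))^{1/2}·‖K^{-1}‖_HS·‖E[A]−K‖_HS + { ‖K‖_op^{1/2}·[ (2√2/(λ(K)^4√3))·(2√6+3√2+2+√d)·‖K^{-1}‖_HS^2·(λ(K)^2+4‖K‖_HS^2) + (2√70·d^2/λ(K)^4)·( (1/2)·max{ |log(2^d det K/(2‖K‖_op+λ(K))^d)|, log(2^d det K/λ(K)^d) } + (√2+1)d/4 ) + (3 + √3/8 + 5√10 + 4√30/3 + √15/3 + 10√5/3)·2d^2/λ(K)^4 ]^{1/2} + 2/λ(K)^2 }·E[‖A−K‖_HS^8]^{1/4}. -/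

import Mathlib

open MeasureTheory ProbabilityTheory Matrix

noncomputable section

/-- Euclidean norm on `Fin d → ℝ`. -/
def euclNorm {d : ℕ} (x : Fin d → ℝ) : ℝ := Real.sqrt (∑ i, x i ^ 2)

/-- Hilbert–Schmidt norm of a matrix. -/
def hsNorm {d : ℕ} (M : Matrix (Fin d) (Fin d) ℝ) : ℝ := Real.sqrt (∑ i, ∑ j, M i j ^ 2)

/-- Operator norm of a matrix (w.r.t. the Euclidean norm). -/
def opNorm {d : ℕ} (M : Matrix (Fin d) (Fin d) ℝ) : ℝ :=
  sSup {r : ℝ | ∃ x : Fin d → ℝ, euclNorm x = 1 ∧ r = euclNorm (M.mulVec x)}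

/-- Smallest eigenvalue of a symmetric matrix (as the infimum of the Rayleigh quotient). -/
def lambdaMin {d : ℕ} (M : Matrix (Fin d) (Fin d) ℝ) : ℝ :=
  sInf {r : ℝ | ∃ x : Fin d → ℝ, euclNorm x = 1 ∧ r = x ⬝ᵥ M.mulVec x}

/-- Density of the centered Gaussian law `N_d(0, M)` on `ℝ^d`. -/
def gaussDensity {d : ℕ} (M : Matrix (Fin d) (Fin d) ℝ) (x : Fin d → ℝ) : ℝ :=
  (Real.sqrt ((2 * Real.pi) ^ d * M.det))⁻¹ * Real.exp (-(1/2) * (x ⬝ᵥ M⁻¹.mulVec x))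

/-- The centered Gaussian law `N_d(0, M)` on `ℝ^d` (for `M` positive definite). -/
def gaussLaw {d : ℕ} (M : Matrix (Fin d) (Fin d) ℝ) : Measure (Fin d → ℝ) :=
  volume.withDensity fun x => ENNReal.ofReal (gaussDensity M x)

/-- Relative entropy (Kullback–Leibler divergence) of `μ` with respect to `ν`. -/
def relEnt {E : Type*} [MeasurableSpace E] (μ ν : Measure E) : ℝ :=
  ∫ x, Real.log ((μ.rnDeriv ν x).toReal) ∂μ

/-- `F` is a centered, integrable random vector which is conditionally Gaussian with respect to
the σ-field `𝓕`, with conditional covariance matrix `A`. -/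
def CondGaussian {Ω : Type*} [MeasurableSpace Ω] (P : Measure Ω) {d : ℕ}
    (F : Ω → Fin d → ℝ) (𝓕 : MeasurableSpace Ω)
    (A : Ω → Matrix (Fin d) (Fin d) ℝ) : Prop :=
  Integrable F P ∧ (∫ ω, F ω ∂P) = 0 ∧
  (∀ ω, (A ω).PosSemidef) ∧
  Measurable[𝓕] (fun ω i j => A ω i j) ∧
  ∀ y : Fin d → ℝ,
    P[(fun ω => Complex.exp (Complex.I * ((y ⬝ᵥ F ω : ℝ) : ℂ))) | 𝓕] =ᵐ[P]
      fun ω => ((Real.exp (-(1/2) * (y ⬝ᵥ (A ω).mulVec y)) : ℝ) : ℂ)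

/-- The dimensional constant `2√6 + 3√2 + 2 + √d`. -/
def Cfac (d : ℕ) : ℝ := 2 * Real.sqrt 6 + 3 * Real.sqrt 2 + 2 + Real.sqrt d

/-- `max{ |log(2^d det K/(2‖K‖_op + λ(K))^d)| , log(2^d det K/λ(K)^d) }`. -/
def maxLog {d : ℕ} (K : Matrix (Fin d) (Fin d) ℝ) : ℝ :=
  max |Real.log ((2 ^ d * K.det) / ((2 * opNorm K + lambdaMin K) ^ d))|
      (Real.log ((2 ^ d * K.det) / (lambdaMin K ^ d)))


/-- Total variation distance between two measures. -/
def dTV {E : Type*} [MeasurableSpace E] (μ ν : Measure E) : ℝ :=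
  sSup {r : ℝ | ∃ B : Set E, MeasurableSet B ∧ r = |(μ B).toReal - (ν B).toReal|}

/-- 2-Wasserstein distance between two measures on `ℝ^d` (with the Euclidean cost). -/
def W2 {d : ℕ} (μ ν : Measure (Fin d → ℝ)) : ℝ :=
  sInf {r : ℝ | ∃ π : Measure ((Fin d → ℝ) × (Fin d → ℝ)), IsProbabilityMeasure π ∧
    π.map Prod.fst = μ ∧ π.map Prod.snd = ν ∧
    r = Real.sqrt (∫ p, (∑ i, (p.1 i - p.2 i) ^ 2) ∂π)}

end

section

open MeasureTheory ProbabilityTheory Matrix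
open scoped ENNReal RealInnerProductSpace

namespace CG

/-- Euclidean space. -/
abbrev EE (d : ℕ) := EuclideanSpace ℝ (Fin d)

/-- action of a matrix on Euclidean space. -/
noncomputable abbrev act {d : ℕ} (M : Matrix (Fin d) (Fin d) ℝ) : EE d →L[ℝ] EE d :=
  Matrix.toEuclideanCLM (n := Fin d) (𝕜 := ℝ) M

/-- standard Gaussian. -/
noncomputable abbrev gam (d : ℕ) : Measure (EE d) := stdGaussian (EE d)

section
open scoped Matrix.Norms.L2Operator MatrixOrder

lemma continuousOn_msqrt (d : ℕ) :
    ContinuousOn (CFC.sqrt : Matrix (Fin d) (Fin d) ℝ → Matrix (Fin d) (Fin d) ℝ)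
      {B | B.PosSemidef} := by
  have := CFC.continuousOn_sqrt (A := Matrix (Fin d) (Fin d) ℝ)
  simpa only [Matrix.nonneg_iff_posSemidef] using this
end

lemma exists_sqrt (d : ℕ) : ∃ sq : Matrix (Fin d) (Fin d) ℝ → Matrix (Fin d) (Fin d) ℝ,
    ContinuousOn sq {B | B.PosSemidef} ∧
    ∀ B, B.PosSemidef → (sq B).PosSemidef ∧ sq B * sq B = B := by
  open scoped MatrixOrder in
  refine ⟨CFC.sqrt, continuousOn_msqrt d, fun B hB => ⟨?_, ?_⟩⟩
  · exact Matrix.nonneg_iff_posSemidef.1 (CFC.sqrt_nonneg B)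
  · exact CFC.sqrt_mul_sqrt_self B hB.nonneg

lemma inner_sq_gam {d : ℕ} (v : EE d) : Integrable (fun z => ⟪v, z⟫ ^ 2) (gam d) ∧
    ∫ z, ⟪v, z⟫ ^ 2 ∂(gam d) = ‖v‖ ^ 2 := by
  have h := variance_dual_stdGaussian (E := EE d) (innerSL ℝ v)
  have hm : MemLp (innerSL ℝ v) 2 (gam d) := IsGaussian.memLp_dual _ _ 2 (by simp)
  rw [variance_eq_integral hm.aestronglyMeasurable.aemeasurable, integral_strongDual_stdGaussian] at h
  simp at h
  refine ⟨?_, h⟩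
  simpa using hm.integrable_sq

lemma norm_pow_integrable (d k : ℕ) : Integrable (fun z => ‖z‖ ^ k) (gam d) := by
  have := (IsGaussian.memLp_id (gam d) k (by simp)).integrable_norm_pow' 
  simpa using this

lemma gam_density (d : ℕ) : gam d = (volume : Measure (EE d)).withDensity
    (fun z => ENNReal.ofReal ((2 * Real.pi) ^ (-(d:ℝ) / 2) * Real.exp (-(1/2) * ‖z‖ ^ 2))) := by
  have hintg : Integrable (fun z : EE d => Real.exp (-(1/2) * ‖z‖ ^ 2)) := by
    have := (GaussianFourier.integrable_cexp_neg_mul_sq_norm_add (V := EE d) (b := 1/2) (by norm_num) 0 0).norm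
    refine this.congr (Filter.Eventually.of_forall fun z => ?_)
    simp only [Complex.norm_exp]
    congr 1
    simp [← Complex.ofReal_pow]
  have hint2 : Integrable (fun z : EE d => (2 * Real.pi) ^ (-(d:ℝ) / 2) * Real.exp (-(1/2) * ‖z‖ ^ 2)) :=
    hintg.const_mul _
  have : IsFiniteMeasure ((volume : Measure (EE d)).withDensity
    (fun z => ENNReal.ofReal ((2 * Real.pi) ^ (-(d:ℝ) / 2) * Real.exp (-(1/2) * ‖z‖ ^ 2)))) :=
    isFiniteMeasure_withDensity_ofReal hint2.2
  apply Measure.ext_of_charFun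
  ext t
  rw [charFun_stdGaussian, charFun_apply, integral_withDensity_eq_integral_toReal_smul (by fun_prop) (by simp)]
  have h := GaussianFourier.integral_cexp_neg_mul_sq_norm_add (V := EE d) (b := 1/2) (by norm_num) Complex.I t
  have e : ∀ x : EE d, ((ENNReal.ofReal ((2 * Real.pi) ^ (-(d:ℝ) / 2) * Real.exp (-(1/2) * ‖x‖ ^ 2))).toReal
      • Complex.exp (⟪x, t⟫ * Complex.I)) = ((2 * Real.pi) ^ (-(d:ℝ) / 2) : ℝ) *
      Complex.exp (-(1/2) * ‖x‖ ^ 2 + Complex.I * ⟪t, x⟫) := by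
    intro x
    rw [ENNReal.toReal_ofReal (by positivity), Complex.exp_add, real_inner_comm, mul_comm Complex.I]
    push_cast
    simp [mul_assoc]
  simp_rw [e]
  rw [integral_const_mul, h]
  simp only [finrank_euclideanSpace, Fintype.card_fin]
  have : ((Real.pi : ℂ) / (1/2)) ^ ((d:ℂ)/2) = (((2 * Real.pi) ^ ((d:ℝ) / 2) : ℝ) : ℂ) := by
    rw [Complex.ofReal_cpow (by positivity)]
    push_cast
    congr 1; ring
  rw [this, ← mul_assoc, ← Complex.ofReal_mul, ← Real.rpow_add (by positivity)]
  rw [show -(d:ℝ)/2 + d/2 = 0 by ring]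
  simp
  congr 1
  ring

lemma moment_succ {d : ℕ} (hd : 1 ≤ d) (k : ℕ) :
    ∫ z, ‖z‖ ^ (k+2) ∂(gam d) = (d + k) * ∫ z, ‖z‖ ^ k ∂(gam d) := by
  have : Nonempty (Fin d) := ⟨⟨0, hd⟩⟩
  have key : ∀ k : ℕ, ∫ z, ‖z‖ ^ k ∂(gam d) = (2 * Real.pi) ^ (-(d:ℝ) / 2) *
      (d * ((volume : Measure (EE d)).real (Metric.ball 0 1) * 
      ((1/2:ℝ) ^ (-((d:ℝ) + k) / 2) * (1 / 2) * Real.Gamma (((d:ℝ) + k) / 2)))) := by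
    intro k
    rw [gam_density, integral_withDensity_eq_integral_toReal_smul (by fun_prop) (by simp)]
    have e : ∀ x : EE d, ((ENNReal.ofReal ((2 * Real.pi) ^ (-(d:ℝ) / 2) * Real.exp (-(1/2) * ‖x‖ ^ 2))).toReal
      • ‖x‖ ^ k) = (2 * Real.pi) ^ (-(d:ℝ) / 2) * (fun r : ℝ => Real.exp (-(1/2) * r ^ 2) * r ^ k) ‖x‖ := by
      intro x
      rw [ENNReal.toReal_ofReal (by positivity)]
      simp [mul_assoc]
    simp_rw [e]
    rw [integral_const_mul, integral_fun_norm_addHaar volume (fun r : ℝ => Real.exp (-(1/2) * r ^ 2) * r ^ k)]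
    simp only [finrank_euclideanSpace, Fintype.card_fin, nsmul_eq_mul, smul_eq_mul]
    congr 3
    have h := integral_rpow_mul_exp_neg_mul_rpow (p := 2) (q := (d:ℝ) - 1 + k) (b := 1/2) (by norm_num) 
      (by have : (1:ℝ) ≤ d := by exact_mod_cast hd
          have : (0:ℝ) ≤ k := by positivity
          linarith) (by norm_num)
    rw [show (d:ℝ) - 1 + k + 1 = d + k by ring] at h
    rw [← h]
    refine setIntegral_congr_fun measurableSet_Ioi fun r hr => ?_
    have hr : (0:ℝ) < r := hr
    have : r ^ ((d:ℝ) - 1 + k) = r ^ (d-1) * r ^ k := by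
      rw [Real.rpow_add hr, Real.rpow_natCast, ← Real.rpow_natCast r (d-1), Nat.cast_sub hd]; simp
    simp only [this, Real.rpow_two]
    ring
  rw [key, key]
  have h1 : (1:ℝ) ≤ d := by exact_mod_cast hd
  have h2 : (0:ℝ) ≤ k := by positivity
  have hG : Real.Gamma (((d:ℝ) + (k+2:ℕ)) / 2) = (((d:ℝ) + k) / 2) * Real.Gamma (((d:ℝ) + k) / 2) := by
    rw [← Real.Gamma_add_one (by linarith)]
    congr 1; push_cast; ring
  have hP : (1/2:ℝ) ^ (-((d:ℝ) + (k+2:ℕ)) / 2) = (1/2:ℝ) ^ (-((d:ℝ) + k) / 2) * 2 := by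
    rw [show -((d:ℝ) + (k+2:ℕ)) / 2 = -((d:ℝ) + k) / 2 + (-1) by push_cast; ring, Real.rpow_add (by norm_num)]
    rw [Real.rpow_neg_one]; norm_num
  rw [hG, hP]
  ring

lemma moment_bound {d : ℕ} (hd : 1 ≤ d) :
    Integrable (fun z => ‖z‖ ^ 2 * (√d + ‖z‖ ^ 2) ^ 2) (gam d) ∧ 
    ∫ z, ‖z‖ ^ 2 * (√d + ‖z‖ ^ 2) ^ 2 ∂(gam d) ≤ 5/4 * (d:ℝ)^3 + 25/2 * (d:ℝ)^2 + 10 * d := by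
  have i2 := norm_pow_integrable d 2
  have i4 := norm_pow_integrable d 4
  have i6 := norm_pow_integrable d 6
  have m0 : ∫ z, ‖z‖ ^ 0 ∂(gam d) = 1 := by simp
  have m2 := moment_succ hd 0
  have m4 := moment_succ hd 2
  have m6 := moment_succ hd 4
  rw [m0] at m2
  norm_num at m2 m4 m6
  rw [m2] at m4
  rw [m4] at m6
  have hs : √(d:ℝ) ^ 2 = d := Real.sq_sqrt (by positivity)
  have hI : Integrable (fun z => ‖z‖ ^ 2 * (√d + ‖z‖ ^ 2) ^ 2) (gam d) := by
    have : (fun z : EE d => ‖z‖ ^ 2 * (√d + ‖z‖ ^ 2) ^ 2) = fun z => √d ^ 2 * ‖z‖ ^ 2 + 2 * √d * ‖z‖ ^ 4 + ‖z‖^6 := by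
      ext z; ring
    rw [this]
    exact ((i2.const_mul _).add (i4.const_mul _)).add i6
  refine ⟨hI, ?_⟩
  calc _ ≤ ∫ z : EE d, (5 * (d:ℝ) * ‖z‖ ^ 2 + 5/4 * ‖z‖ ^ 6) ∂(gam d) := by
        refine integral_mono hI ((i2.const_mul _).add (i6.const_mul _)) fun z => ?_
        have : (√d + ‖z‖ ^ 2) ^ 2 ≤ 5 * d + 5/4 * ‖z‖ ^ 4 := by
          nlinarith [sq_nonneg (4 * √d - ‖z‖ ^ 2)]
        calc ‖z‖ ^ 2 * (√d + ‖z‖ ^ 2) ^ 2 ≤ ‖z‖ ^ 2 * (5 * d + 5/4 * ‖z‖ ^ 4) := by gcongr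
          _ = _ := by ring
    _ = 5 * (d:ℝ) * d + 5/4 * (((d:ℝ) + 4) * (((d:ℝ) + 2) * d)) := by
        rw [integral_add (i2.const_mul _) (i6.const_mul _), integral_const_mul, integral_const_mul, m2, m6]
    _ ≤ _ := by
        apply le_of_eq; ring

end CG

end

section

open MeasureTheory ProbabilityTheory Matrix
open scoped ENNReal RealInnerProductSpace
open scoped Matrix.Norms.Frobenius
namespace CG

lemma fro_sq {d : ℕ} (M : Matrix (Fin d) (Fin d) ℝ) : ‖M‖ ^ 2 = ∑ i, ∑ j, M i j ^ 2 := by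
  rw [Matrix.frobenius_norm_def, ← Real.sqrt_eq_rpow, Real.sq_sqrt (by positivity)]
  simp

lemma hsNorm_eq {d : ℕ} (M : Matrix (Fin d) (Fin d) ℝ) : hsNorm M = ‖M‖ := by
  rw [hsNorm, ← fro_sq, Real.sqrt_sq (norm_nonneg _)]

lemma fro_sq_trace {d : ℕ} (M : Matrix (Fin d) (Fin d) ℝ) : ‖M‖ ^ 2 = (Mᵀ * M).trace := by
  rw [fro_sq, Finset.sum_comm]
  simp [Matrix.trace, Matrix.mul_apply, sq]

lemma fro_one {d : ℕ} : ‖(1 : Matrix (Fin d) (Fin d) ℝ)‖ = √d := by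
  rw [← Real.sqrt_sq (norm_nonneg _), fro_sq_trace]; simp

lemma act_apply {d : ℕ} (M : Matrix (Fin d) (Fin d) ℝ) (z : EE d) (i : Fin d) :
    act M z i = ∑ j, M i j * z j := by
  simp [act, Matrix.ofLp_toEuclideanCLM, Matrix.mulVec, dotProduct]

lemma act_mul {d : ℕ} (M N : Matrix (Fin d) (Fin d) ℝ) (z : EE d) :
    act (M * N) z = act M (act N z) := by
  simp [act]

lemma norm_act_sq {d : ℕ} (M : Matrix (Fin d) (Fin d) ℝ) (z : EE d) :
    ‖act M z‖ ^ 2 = ∑ i, ⟪(WithLp.toLp 2 (M i) : EE d), z⟫ ^ 2 := by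
  rw [EuclideanSpace.norm_sq_eq]
  refine Finset.sum_congr rfl fun i _ => ?_
  rw [act_apply, Real.norm_eq_abs, sq_abs]
  congr 1
  simp [PiLp.inner_apply, mul_comm]

lemma sum_rows {d : ℕ} (M : Matrix (Fin d) (Fin d) ℝ) :
    ∑ i, ‖(WithLp.toLp 2 (M i) : EE d)‖ ^ 2 = ‖M‖ ^ 2 := by
  rw [fro_sq]
  refine Finset.sum_congr rfl fun i _ => ?_
  rw [EuclideanSpace.norm_sq_eq]; simp

lemma norm_act_le {d : ℕ} (M : Matrix (Fin d) (Fin d) ℝ) (z : EE d) : ‖act M z‖ ≤ ‖M‖ * ‖z‖ := by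
  refine (sq_le_sq₀ (by positivity) (by positivity)).1 ?_
  rw [norm_act_sq, mul_pow, ← sum_rows, Finset.sum_mul]
  refine Finset.sum_le_sum fun i _ => ?_
  rw [← mul_pow]
  exact sq_le_sq.2 (by rw [abs_of_nonneg (a := ‖_‖ * ‖z‖) (by positivity)]; exact abs_real_inner_le_norm _ _)

lemma act_gam {d : ℕ} (M : Matrix (Fin d) (Fin d) ℝ) :
    Integrable (fun z => ‖act M z‖ ^ 2) (gam d) ∧ ∫ z, ‖act M z‖ ^ 2 ∂(gam d) = ‖M‖ ^ 2 := by
  simp_rw [norm_act_sq]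
  refine ⟨integrable_finsetSum _ fun i _ => (inner_sq_gam _).1, ?_⟩
  rw [integral_finsetSum _ fun i _ => (inner_sq_gam _).1, ← sum_rows]
  exact Finset.sum_congr rfl fun i _ => (inner_sq_gam _).2

lemma det_act {d : ℕ} (M : Matrix (Fin d) (Fin d) ℝ) : (act M).det = M.det := by
  have : ((act M : EE d →L[ℝ] EE d) : EE d →ₗ[ℝ] EE d) = 
    Matrix.toLin (EuclideanSpace.basisFun (Fin d) ℝ).toBasis (EuclideanSpace.basisFun (Fin d) ℝ).toBasis M := by
    rw [act, Matrix.coe_toEuclideanCLM_eq_toEuclideanLin, Matrix.toEuclideanLin_eq_toLin_orthonormal]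
  rw [ContinuousLinearMap.det, this, LinearMap.det_toLin]

lemma det_bound {d : ℕ} (M : Matrix (Fin d) (Fin d) ℝ) : |M.det| ≤ Real.exp ((‖M‖ ^ 2 - d) / 2) := by
  have hP : (Mᵀ * M).PosSemidef := by
    simpa using Matrix.posSemidef_conjTranspose_mul_self M
  have h1 : (Mᵀ * M).det = ∏ i, hP.1.eigenvalues i := by simpa using hP.1.det_eq_prod_eigenvalues
  have h2 : (Mᵀ * M).trace = ∑ i, hP.1.eigenvalues i := by simpa using hP.1.trace_eq_sum_eigenvalues
  have h3 : M.det ^ 2 ≤ Real.exp (‖M‖ ^ 2 - d) := by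
    have : M.det ^ 2 = (Mᵀ * M).det := by simp [sq]
    rw [this, h1, fro_sq_trace, h2]
    calc ∏ i, hP.1.eigenvalues i ≤ ∏ i, Real.exp (hP.1.eigenvalues i - 1) :=
          Finset.prod_le_prod (fun i _ => hP.eigenvalues_nonneg i) fun i _ => by
            have := Real.add_one_le_exp (hP.1.eigenvalues i - 1); linarith
      _ = _ := by rw [← Real.exp_sum]; simp
  refine (sq_le_sq₀ (by positivity) (by positivity)).1 ?_
  rw [sq_abs, ← Real.exp_nat_mul]
  have e : ((2:ℕ):ℝ) * ((‖M‖^2 - d)/2) = ‖M‖^2 - d := by push_cast; ring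
  rw [e]; exact h3

end CG

end

section

open MeasureTheory ProbabilityTheory Matrix
open scoped ENNReal RealInnerProductSpace
open scoped Matrix.Norms.Frobenius
namespace CG

/-- density ratio -/
noncomputable def rat {d : ℕ} (T : Matrix (Fin d) (Fin d) ℝ) (w : EE d) : ℝ :=
  |T.det| * Real.exp (-(1/2) * (‖act T w‖ ^ 2 - ‖w‖ ^ 2))

lemma gam_int (d : ℕ) (f : EE d → ℝ) : (Integrable f (gam d) ↔ 
    Integrable (fun z => ((2 * Real.pi) ^ (-(d:ℝ) / 2) * Real.exp (-(1/2) * ‖z‖ ^ 2)) * f z)) ∧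
    ∫ z, f z ∂(gam d) = ∫ z, ((2 * Real.pi) ^ (-(d:ℝ) / 2) * Real.exp (-(1/2) * ‖z‖ ^ 2)) * f z := by
  have e : ∀ x : EE d, ((ENNReal.ofReal ((2 * Real.pi) ^ (-(d:ℝ) / 2) * Real.exp (-(1/2) * ‖x‖ ^ 2))).toReal)
     = (2 * Real.pi) ^ (-(d:ℝ) / 2) * Real.exp (-(1/2) * ‖x‖ ^ 2) := fun x => 
    ENNReal.toReal_ofReal (by positivity)
  rw [gam_density]
  constructor
  · rw [integrable_withDensity_iff_integrable_smul' (by fun_prop) (by simp)]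
    simp_rw [e, smul_eq_mul]
  · rw [integral_withDensity_eq_integral_toReal_smul (by fun_prop) (by simp)]
    simp_rw [e, smul_eq_mul]

lemma act_inj {d : ℕ} {T : Matrix (Fin d) (Fin d) ℝ} (hT : IsUnit T.det) : 
    Function.Injective (act T) := by
  intro x y h
  have : act T⁻¹ (act T x) = act T⁻¹ (act T y) := by rw [h]
  rw [← act_mul, ← act_mul, Matrix.nonsing_inv_mul _ hT] at this
  simpa using this

lemma act_surj {d : ℕ} {T : Matrix (Fin d) (Fin d) ℝ} (hT : IsUnit T.det) : 
    Function.Surjective (act T) := by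
  intro y
  refine ⟨act T⁻¹ y, ?_⟩
  rw [← act_mul, Matrix.mul_nonsing_inv _ hT]; simp

lemma change {d : ℕ} {T : Matrix (Fin d) (Fin d) ℝ} (hT : IsUnit T.det) (f : EE d → ℝ) :
    (Integrable f (gam d) ↔ Integrable (fun w => f (act T w) * rat T w) (gam d)) ∧
    ∫ z, f z ∂(gam d) = ∫ w, f (act T w) * rat T w ∂(gam d) := by
  rw [(gam_int d f).1, (gam_int d f).2, (gam_int d _).1, (gam_int d _).2]
  set c := (2 * Real.pi) ^ (-(d:ℝ) / 2)
  have hd : ∀ x ∈ (Set.univ : Set (EE d)), HasFDerivWithinAt (act T) (act T) Set.univ x := 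
    fun x _ => (act T).hasFDerivWithinAt
  have hr : Set.image (act T) Set.univ = Set.univ := by
    rw [Set.image_univ]; exact (act_surj hT).range_eq
  have e : ∀ w : EE d, c * Real.exp (-(1/2) * ‖w‖ ^ 2) * (f (act T w) * rat T w) = 
     |(act T).det| • (c * Real.exp (-(1/2) * ‖act T w‖ ^ 2) * f (act T w)) := by
    intro w
    rw [det_act, rat, smul_eq_mul]
    have : Real.exp (-(1/2) * ‖act T w‖ ^ 2) = Real.exp (-(1/2) * ‖w‖ ^ 2) * Real.exp (-(1/2) * (‖act T w‖ ^ 2 - ‖w‖ ^ 2)) := by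
      rw [← Real.exp_add]; congr 1; ring
    rw [this]; ring
  simp_rw [e]
  constructor
  · have := integrableOn_image_iff_integrableOn_abs_det_fderiv_smul volume MeasurableSet.univ hd
      (act_inj hT).injOn (fun z => c * Real.exp (-(1/2) * ‖z‖ ^ 2) * f z)
    rwa [hr, integrableOn_univ, integrableOn_univ] at this
  · have := integral_image_eq_integral_abs_det_fderiv_smul volume MeasurableSet.univ hd
      (act_inj hT).injOn (fun z => c * Real.exp (-(1/2) * ‖z‖ ^ 2) * f z)
    rwa [hr, setIntegral_univ, setIntegral_univ] at this

lemma abs_sub_one_le {r l : ℝ} (hr : 0 < r) (h : |Real.log r| ≤ l) : |r - 1| ≤ l * (1 + r) := by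
  have h1 : Real.log r ≤ r - 1 := Real.log_le_sub_one_of_pos hr
  have h2 : 1 - r⁻¹ ≤ Real.log r := by
    have := Real.log_le_sub_one_of_pos (inv_pos.2 hr)
    rw [Real.log_inv] at this; linarith
  have h3 := abs_le.1 h
  have h4 : r - 1 ≤ r * Real.log r := by
    have := mul_le_mul_of_nonneg_left h2 hr.le
    rwa [mul_sub, mul_inv_cancel₀ hr.ne', mul_one] at this
  rw [abs_le]
  constructor <;> nlinarith

lemma norm_diff_bound {d : ℕ} {T : Matrix (Fin d) (Fin d) ℝ} {e : ℝ} (h : ‖T - 1‖ ≤ e) (w : EE d) :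
    ‖act T w‖ ^ 2 - ‖w‖ ^ 2 ≤ (2 * e + e ^ 2) * ‖w‖ ^ 2 := by
  have h1 : ‖act T w‖ ≤ (1 + e) * ‖w‖ := by
    have : act T w = w + act (T - 1) w := by simp [act]
    rw [this]
    calc _ ≤ ‖w‖ + ‖act (T - 1) w‖ := norm_add_le _ _
      _ ≤ ‖w‖ + e * ‖w‖ := by
        gcongr
        exact (norm_act_le _ _).trans (by gcongr)
      _ = _ := by ring
  have := pow_le_pow_left₀ (norm_nonneg _) h1 2
  nlinarith

lemma norm_diff_bound' {d : ℕ} {T : Matrix (Fin d) (Fin d) ℝ} {e : ℝ} (h : ‖T - 1‖ ≤ e) (w : EE d) :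
    ‖w‖ ^ 2 - ‖act T w‖ ^ 2 ≤ (2 * e + e ^ 2) * ‖w‖ ^ 2 := by
  have he : 0 ≤ e := (norm_nonneg _).trans h
  have h1 : ‖w‖ ≤ ‖act T w‖ + e * ‖w‖ := by
    have : w = act T w - act (T - 1) w := by simp [act]
    calc ‖w‖ = ‖act T w - act (T - 1) w‖ := by rw [← this]
      _ ≤ ‖act T w‖ + ‖act (T - 1) w‖ := norm_sub_le _ _
      _ ≤ ‖act T w‖ + e * ‖w‖ := by
        gcongr
        exact (norm_act_le _ _).trans (by gcongr)
  have h0 := norm_nonneg w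
  have h2 := norm_nonneg (act T w)
  by_cases h3 : ‖act T w‖ ≤ ‖w‖
  · nlinarith [mul_nonneg he h0, mul_nonneg (mul_nonneg he he) (mul_nonneg h0 h0)]
  · have : ‖w‖ ^ 2 ≤ ‖act T w‖ ^ 2 := by gcongr; linarith
    have : 0 ≤ (2 * e + e ^ 2) * ‖w‖ ^ 2 := by positivity
    linarith

lemma det_log {d : ℕ} {T : Matrix (Fin d) (Fin d) ℝ} {e : ℝ} (hd : 1 ≤ d) (hT : IsUnit T.det) (h : ‖T - 1‖ ≤ e) :
    Real.log |T.det| ≤ (e + e ^ 2 / 2) * √d := by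
  have he : 0 ≤ e := (norm_nonneg _).trans h
  have h1 : ‖T‖ ≤ √d + e := by
    rw [← fro_one]
    calc ‖T‖ = ‖1 + (T - 1)‖ := by congr 1; abel
      _ ≤ _ := (norm_add_le _ _).trans (by gcongr)
  have h2 : Real.log |T.det| ≤ (‖T‖ ^ 2 - d) / 2 := by
    rw [Real.log_le_iff_le_exp (by simpa using hT.ne_zero)]
    exact det_bound T
  have h3 := pow_le_pow_left₀ (norm_nonneg _) h1 2
  have hs : √(d:ℝ) ^ 2 = d := Real.sq_sqrt (by positivity)
  have h4 : 1 ≤ √(d:ℝ) := Real.one_le_sqrt.2 (by exact_mod_cast hd)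
  nlinarith [mul_nonneg (mul_nonneg he he) (sub_nonneg.2 h4)]

lemma log_rat {d : ℕ} {T : Matrix (Fin d) (Fin d) ℝ} {e : ℝ} (hd : 1 ≤ d) (hT : IsUnit T.det) (h : ‖T - 1‖ ≤ e)
    (h' : ‖T⁻¹ - 1‖ ≤ e) (w : EE d) : 0 < rat T w ∧
    |Real.log (rat T w)| ≤ (e + e ^ 2 / 2) * (√d + ‖w‖ ^ 2) ∧ 
    |Real.log (rat T w)| ≤ (e + e ^ 2 / 2) * (√d + ‖act T w‖ ^ 2) := by
  have hp : 0 < |T.det| := by simpa using hT.ne_zero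
  have e1 : Real.log (rat T w) = Real.log |T.det| - (1/2) * (‖act T w‖ ^ 2 - ‖w‖ ^ 2) := by
    rw [rat, Real.log_mul hp.ne' (by positivity), Real.log_exp]; ring
  have d1 := det_log hd hT h
  have hT' : IsUnit (T⁻¹).det := by rw [Matrix.isUnit_nonsing_inv_det_iff]; exact hT
  have d2 := det_log hd hT' h'
  have e2 : Real.log |T⁻¹.det| = - Real.log |T.det| := by
    rw [Matrix.det_nonsing_inv, Ring.inverse_eq_inv', abs_inv, Real.log_inv]
  rw [e2] at d2
  have n1 := norm_diff_bound h w
  have n2 := norm_diff_bound' h w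
  have n3 := norm_diff_bound h' (act T w)
  have n4 := norm_diff_bound' h' (act T w)
  have e3 : act T⁻¹ (act T w) = w := by
    rw [← act_mul, Matrix.nonsing_inv_mul _ hT]; simp
  rw [e3] at n3 n4
  refine ⟨by unfold rat; positivity, ?_, ?_⟩
  · rw [e1, abs_le]; constructor <;> linarith
  · rw [e1, abs_le]; constructor <;> linarith

/-- Comparison of expectations under two Gaussian laws. -/
lemma pair_bound {d : ℕ} (hd : 1 ≤ d) {S S' : Matrix (Fin d) (Fin d) ℝ} {e : ℝ} (hS : IsUnit S.det) (hS' : IsUnit S'.det)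
    (h : ‖S⁻¹ * S' - 1‖ ≤ e) (h' : ‖S'⁻¹ * S - 1‖ ≤ e) (u : EE d → ℝ)
    (i1 : Integrable (fun z => u (act S z)) (gam d)) (i2 : Integrable (fun z => u (act S' z)) (gam d))
    (j1 : Integrable (fun z => |u (act S z)| * (√d + ‖z‖ ^ 2)) (gam d)) 
    (j2 : Integrable (fun z => |u (act S' z)| * (√d + ‖z‖ ^ 2)) (gam d)) :
    |∫ z, u (act S z) ∂(gam d) - ∫ z, u (act S' z) ∂(gam d)| ≤ 
      (e + e ^ 2 / 2) * (∫ z, |u (act S z)| * (√d + ‖z‖ ^ 2) ∂(gam d) + ∫ z, |u (act S' z)| * (√d + ‖z‖ ^ 2) ∂(gam d)) := by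
  set T := S⁻¹ * S' with hTdef
  have hT : IsUnit T.det := by
    rw [hTdef, Matrix.det_mul]
    exact ((Matrix.isUnit_nonsing_inv_det_iff).2 hS).mul hS'
  have hTi : T⁻¹ = S'⁻¹ * S := by
    rw [hTdef, Matrix.mul_inv_rev, Matrix.nonsing_inv_nonsing_inv _ hS]
  rw [← hTi] at h'
  have hST : ∀ w, act S (act T w) = act S' w := by
    intro w
    rw [← act_mul, hTdef, Matrix.mul_nonsing_inv_cancel_left _ _ hS]
  have c1 := change hT (fun z => u (act S z))
  have c2 := change hT (fun z => |u (act S z)| * (√d + ‖z‖ ^ 2))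
  simp only [hST] at c1 c2
  have i1' := c1.1.1 i1
  have j1' := c2.1.1 j1
  rw [c1.2, c2.2, ← integral_sub i1' i2, ← integral_add j1' j2, ← integral_const_mul]
  rw [← Real.norm_eq_abs]
  refine norm_integral_le_of_norm_le ((j1'.add j2).const_mul _) (Filter.Eventually.of_forall fun w => ?_)
  obtain ⟨hp, l1, l2⟩ := log_rat hd hT h h' w
  rw [Real.norm_eq_abs]
  have hr : |rat T w - 1| ≤ |Real.log (rat T w)| * (1 + rat T w) := abs_sub_one_le hp le_rfl
  calc |u (act S' w) * rat T w - u (act S' w)| = |u (act S' w)| * |rat T w - 1| := by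
        rw [← abs_mul]; congr 1; ring
    _ ≤ |u (act S' w)| * (|Real.log (rat T w)| * (1 + rat T w)) := by gcongr
    _ = |u (act S' w)| * |Real.log (rat T w)| + |u (act S' w)| * |Real.log (rat T w)| * rat T w := by ring
    _ ≤ |u (act S' w)| * ((e + e ^ 2 / 2) * (√d + ‖w‖ ^ 2)) + |u (act S' w)| * ((e + e ^ 2 / 2) * (√d + ‖act T w‖ ^ 2)) * rat T w := by
        gcongr
    _ = _ := by ring

end CG

end

section

open MeasureTheory ProbabilityTheory Matrix
open scoped ENNReal RealInnerProductSpace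
namespace CG

lemma sq_integral_le {α : Type*} [MeasurableSpace α] {μ : Measure α} [IsProbabilityMeasure μ] {f : α → ℝ}
    (hf : Integrable f μ) (hf2 : Integrable (fun x => f x ^ 2) μ) : (∫ x, f x ∂μ) ^ 2 ≤ ∫ x, f x ^ 2 ∂μ := by
  set c := ∫ x, f x ∂μ with hc
  have h : 0 ≤ ∫ x, (f x - c) ^ 2 ∂μ := integral_nonneg fun x => sq_nonneg _
  have e : ∀ x, (f x - c) ^ 2 = f x ^ 2 - 2 * c * f x + c ^ 2 := fun x => by ring
  simp_rw [e] at h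
  rw [integral_add (by fun_prop) (integrable_const _), integral_sub hf2 (hf.const_mul _),
    integral_const_mul, integral_const, ← hc] at h
  simp at h
  nlinarith

/-- Cauchy-Schwarz for integrals of inner products -/
lemma cs_inner {α : Type*} [MeasurableSpace α] {μ : Measure α} {d : ℕ} {f g : α → EE d}
    (mf : AEStronglyMeasurable f μ) (mg : AEStronglyMeasurable g μ)
    (hf : Integrable (fun x => ‖f x‖ ^ 2) μ) (hg : Integrable (fun x => ‖g x‖ ^ 2) μ) :
    Integrable (fun x => ⟪f x, g x⟫) μ ∧ 
    |∫ x, ⟪f x, g x⟫ ∂μ| ≤ √(∫ x, ‖f x‖ ^ 2 ∂μ) * √(∫ x, ‖g x‖ ^ 2 ∂μ) := by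
  have hf' : MemLp f 2 μ := (memLp_two_iff_integrable_sq_norm mf).2 hf
  have hg' : MemLp g 2 μ := (memLp_two_iff_integrable_sq_norm mg).2 hg
  have hi : Integrable (fun x => ⟪f x, g x⟫) μ := by
    refine (hf.add hg).mono (mf.inner mg) (Filter.Eventually.of_forall fun x => ?_)
    rw [Real.norm_eq_abs, Real.norm_eq_abs]
    refine (abs_real_inner_le_norm _ _).trans (le_trans ?_ (le_abs_self _))
    simp only [Pi.add_apply]
    nlinarith [sq_nonneg (‖f x‖ - ‖g x‖), sq_nonneg (‖f x‖), sq_nonneg (‖g x‖)]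
  refine ⟨hi, ?_⟩
  have h1 : |∫ x, ⟪f x, g x⟫ ∂μ| ≤ ∫ x, ‖f x‖ * ‖g x‖ ∂μ := by
    rw [← Real.norm_eq_abs]
    refine norm_integral_le_of_norm_le ?_ (Filter.Eventually.of_forall fun x => ?_)
    · exact hf'.norm.integrable_mul hg'.norm
    · rw [Real.norm_eq_abs]; exact abs_real_inner_le_norm _ _
  refine h1.trans ?_
  have h2 := integral_mul_le_Lp_mul_Lq_of_nonneg (μ := μ) (f := fun x => ‖f x‖) (g := fun x => ‖g x‖) 
    Real.HolderConjugate.two_two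
    (Filter.Eventually.of_forall fun x => norm_nonneg _) (Filter.Eventually.of_forall fun x => norm_nonneg _)
    (by simpa using hf'.norm) (by simpa using hg'.norm)
  simpa [Real.sqrt_eq_rpow] using h2

lemma glue {d : ℕ} {π ρ : Measure (EE d × EE d)} [IsProbabilityMeasure π] [IsProbabilityMeasure ρ]
    (h : π.snd = ρ.fst) (iπ : Integrable (fun p => ‖p.1 - p.2‖ ^ 2) π)
    (iρ : Integrable (fun p => ‖p.1 - p.2‖ ^ 2) ρ) {s a b : ℝ} (hs : 0 ≤ s) (ha : 0 ≤ a)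
    (hπ : ∫ p, ‖p.1 - p.2‖ ^ 2 ∂π ≤ s ^ 2) (hρ : ∫ p, ‖p.1 - p.2‖ ^ 2 ∂ρ ≤ b)
    (hg : ∀ g : EE d → EE d, Measurable g → Integrable (fun p => ‖g p.1‖ ^ 2) ρ → 
      ∫ p, ⟪g p.1, p.2 - p.1⟫ ∂ρ ≤ a * √(∫ p, ‖g p.1‖ ^ 2 ∂ρ)) :
    ∃ π' : Measure (EE d × EE d), IsProbabilityMeasure π' ∧ π'.fst = π.fst ∧ π'.snd = ρ.snd ∧ 
      Integrable (fun p => ‖p.1 - p.2‖ ^ 2) π' ∧ ∫ p, ‖p.1 - p.2‖ ^ 2 ∂π' ≤ s ^ 2 + 2 * s * a + b := by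
  set κ := ρ.condKernel with hκ
  have hd : ρ.fst ⊗ₘ κ = ρ := ρ.disintegrate κ
  set QQ := π ⊗ₘ (κ.comap Prod.snd measurable_snd) with hQQ
  have hfst : QQ.map Prod.fst = π := by
    have : QQ.fst = π := Measure.fst_compProd _ _
    exact this
  have hsnd : QQ.map (fun q : (EE d × EE d) × EE d => (q.1.2, q.2)) = ρ := by
    conv_rhs => rw [← hd, ← h]
    ext t ht
    have hm : Measurable (fun q : (EE d × EE d) × EE d => (q.1.2, q.2)) := by fun_prop
    rw [Measure.map_apply hm ht, hQQ, Measure.compProd_apply (hm ht), Measure.compProd_apply ht, Measure.snd,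
      lintegral_map (Kernel.measurable_kernel_prodMk_left ht) measurable_snd]
    rfl
  have hm1 : Measurable (fun q : (EE d × EE d) × EE d => (q.1.1, q.2)) := by fun_prop
  have hm2 : Measurable (fun q : (EE d × EE d) × EE d => (q.1.2, q.2)) := by fun_prop
  -- the drift
  set m : EE d → EE d := fun x => ∫ y, (y - x) ∂(κ x) with hm
  have mm : Measurable m := by
    have : StronglyMeasurable (fun p : EE d × EE d => p.2 - p.1) := by fun_prop
    exact (StronglyMeasurable.integral_kernel_prod_right' this).measurable
  have iρ' := iρ
  rw [← hd, Measure.integrable_compProd_iff (by fun_prop)] at iρ'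
  obtain ⟨r1, r2⟩ := iρ'
  have rsq : ∀ᵐ x ∂ρ.fst, Integrable (fun y => y - x) (κ x) ∧ ‖m x‖ ^ 2 ≤ ∫ y, ‖x - y‖ ^ 2 ∂(κ x) := by
    filter_upwards [r1] with x hx
    have hx' : Integrable (fun y => ‖y - x‖ ^ 2) (κ x) := by simpa [norm_sub_rev] using hx
    have hL : MemLp (fun y => y - x) 2 (κ x) := (memLp_two_iff_integrable_sq_norm (by fun_prop)).2 hx'
    have hi : Integrable (fun y => y - x) (κ x) := hL.integrable (by norm_num)
    refine ⟨hi, ?_⟩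
    calc ‖m x‖ ^ 2 ≤ (∫ y, ‖y - x‖ ∂(κ x)) ^ 2 := by
          gcongr; exact norm_integral_le_integral_norm _
      _ ≤ ∫ y, ‖y - x‖ ^ 2 ∂(κ x) := sq_integral_le hi.norm hx'
      _ = _ := by simp_rw [norm_sub_rev]
  have im : Integrable (fun x => ‖m x‖ ^ 2) ρ.fst := by
    refine Integrable.mono' (g := fun x => ∫ y, ‖x - y‖ ^ 2 ∂(κ x)) (by simpa using r2) (by fun_prop) ?_
    filter_upwards [rsq] with x hx
    simpa using hx.2
  have im' : Integrable (fun p : EE d × EE d => ‖m p.1‖ ^ 2) ρ := by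
    exact (integrable_map_measure (μ := ρ) (f := Prod.fst) (g := fun x => ‖m x‖ ^ 2) (by fun_prop) (by fun_prop)).1 im
  have em : ∫ p : EE d × EE d, ‖m p.1‖ ^ 2 ∂ρ = ∫ x, ‖m x‖ ^ 2 ∂ρ.fst := by
    rw [Measure.fst, integral_map (by fun_prop) (by fun_prop)]
  have hmm : √(∫ x, ‖m x‖ ^ 2 ∂ρ.fst) ≤ a := by
    have h1 := hg m mm im'
    rw [em] at h1
    have hin : Integrable (fun p : EE d × EE d => ⟪m p.1, p.2 - p.1⟫) ρ := 
      (cs_inner (mm.comp measurable_fst).aestronglyMeasurable (by fun_prop) im' (by simpa [norm_sub_rev] using iρ)).1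
    have h2 : ∫ p, ⟪m p.1, p.2 - p.1⟫ ∂ρ = ∫ x, ‖m x‖ ^ 2 ∂ρ.fst := by
      have hin' := hin
      rw [← hd] at hin'
      conv_lhs => rw [← hd]
      rw [Measure.integral_compProd hin']
      refine integral_congr_ae ?_
      filter_upwards [rsq] with x hx
      rw [integral_inner hx.1, real_inner_self_eq_norm_sq]
    rw [h2] at h1
    have h3 := Real.sqrt_nonneg (∫ x, ‖m x‖ ^ 2 ∂ρ.fst)
    have h4 := Real.sq_sqrt (integral_nonneg (fun x => sq_nonneg ‖m x‖) : 0 ≤ ∫ x, ‖m x‖ ^ 2 ∂ρ.fst)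
    by_contra hc
    push Not at hc
    nlinarith
  -- U, V in L²
  have iU : Integrable (fun q : (EE d × EE d) × EE d => ‖q.1.1 - q.1.2‖ ^ 2) QQ := by
    rw [← hfst] at iπ
    exact (integrable_map_measure (by fun_prop) (by fun_prop)).1 iπ
  have eU : ∫ q, ‖q.1.1 - q.1.2‖ ^ 2 ∂QQ = ∫ p, ‖p.1 - p.2‖ ^ 2 ∂π := by
    rw [← hfst, integral_map (by fun_prop) (by fun_prop)]
  have iV : Integrable (fun q : (EE d × EE d) × EE d => ‖q.2 - q.1.2‖ ^ 2) QQ := by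
    rw [← hsnd] at iρ
    have := (integrable_map_measure (by fun_prop) (by fun_prop)).1 iρ
    simpa [norm_sub_rev, Function.comp_def] using this
  have eV : ∫ q, ‖q.2 - q.1.2‖ ^ 2 ∂QQ = ∫ p, ‖p.1 - p.2‖ ^ 2 ∂ρ := by
    rw [← hsnd, integral_map (by fun_prop) (by fun_prop)]
    simp_rw [norm_sub_rev]
  have iUV : Integrable (fun q : (EE d × EE d) × EE d => ⟪q.1.1 - q.1.2, q.2 - q.1.2⟫) QQ := 
    (cs_inner (by fun_prop) (by fun_prop) iU iV).1
  have imπ : Integrable (fun p : EE d × EE d => ‖m p.2‖ ^ 2) π := by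
    rw [← h] at im
    exact (integrable_map_measure (μ := π) (f := Prod.snd) (g := fun x => ‖m x‖ ^ 2) (by fun_prop) (by fun_prop)).1 im
  have emπ : ∫ p : EE d × EE d, ‖m p.2‖ ^ 2 ∂π = ∫ x, ‖m x‖ ^ 2 ∂ρ.fst := by
    rw [← h, Measure.snd, integral_map (by fun_prop) (by fun_prop)]
  have hUV : |∫ q, ⟪q.1.1 - q.1.2, q.2 - q.1.2⟫ ∂QQ| ≤ s * a := by
    have e : ∫ q, ⟪q.1.1 - q.1.2, q.2 - q.1.2⟫ ∂QQ = ∫ p, ⟪p.1 - p.2, m p.2⟫ ∂π := by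
      rw [hQQ, Measure.integral_compProd iUV]
      refine integral_congr_ae ?_
      have rsq' : ∀ᵐ p ∂π, Integrable (fun y => y - p.2) (κ p.2) := by
        have : ∀ᵐ x ∂π.snd, Integrable (fun y => y - x) (κ x) := by
          rw [h]; filter_upwards [rsq] with x hx using hx.1
        exact ae_of_ae_map (by fun_prop) this
      filter_upwards [rsq'] with p hp
      simp only [Kernel.comap_apply]
      rw [integral_inner hp]
    rw [e]
    refine (cs_inner (by fun_prop) (mm.comp measurable_snd).aestronglyMeasurable iπ imπ).2.trans ?_
    simp only [Function.comp_apply]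
    rw [emπ]
    gcongr
    exact Real.sqrt_le_iff.2 ⟨hs, hπ⟩
  refine ⟨QQ.map (fun q : (EE d × EE d) × EE d => (q.1.1, q.2)), Measure.isProbabilityMeasure_map (by fun_prop), ?_, ?_, ?_, ?_⟩
  · rw [Measure.fst_map_prodMk (by fun_prop)]
    conv_rhs => rw [← hfst, Measure.fst, Measure.map_map (by fun_prop) (by fun_prop)]
    rfl
  · rw [Measure.snd_map_prodMk (by fun_prop)]
    conv_rhs => rw [← hsnd, Measure.snd, Measure.map_map (by fun_prop) (by fun_prop)]
    rfl
  · rw [integrable_map_measure (by fun_prop) (by fun_prop)]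
    have : Integrable (fun q : (EE d × EE d) × EE d => ‖q.1.1 - q.1.2‖ ^ 2 - 2 * ⟪q.1.1 - q.1.2, q.2 - q.1.2⟫ + ‖q.2 - q.1.2‖ ^ 2) QQ :=
      (iU.sub (iUV.const_mul 2)).add iV
    refine this.congr (Filter.Eventually.of_forall fun q => ?_)
    simp only [Function.comp]
    rw [← norm_sub_sq_real]; congr 2; abel
  · rw [integral_map (by fun_prop) (by fun_prop)]
    have e : ∀ q : (EE d × EE d) × EE d, ‖q.1.1 - q.2‖ ^ 2 = ‖q.1.1 - q.1.2‖ ^ 2 - 2 * ⟪q.1.1 - q.1.2, q.2 - q.1.2⟫ + ‖q.2 - q.1.2‖ ^ 2 := by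
      intro q
      rw [← norm_sub_sq_real]; congr 2; abel
    simp_rw [e]
    rw [integral_add (by fun_prop) iV, integral_sub iU (iUV.const_mul 2), integral_const_mul, eU, eV]
    have := (abs_le.1 hUV).1
    linarith

end CG

end

section

open MeasureTheory ProbabilityTheory Matrix
open scoped ENNReal RealInnerProductSpace
open scoped Matrix.Norms.Frobenius
namespace CG

/-- radial moment -/
noncomputable def Rd (d : ℕ) : ℝ := ∫ z : EE d, ‖z‖ ^ 2 * (√d + ‖z‖ ^ 2) ^ 2 ∂(gam d)

lemma act_add {d : ℕ} (M N : Matrix (Fin d) (Fin d) ℝ) (z : EE d) : act (M + N) z = act M z + act N z := by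
  simp [act]
lemma act_sub {d : ℕ} (M N : Matrix (Fin d) (Fin d) ℝ) (z : EE d) : act (M - N) z = act M z - act N z := by
  simp [act]
lemma act_smul {d : ℕ} (t : ℝ) (M : Matrix (Fin d) (Fin d) ℝ) (z : EE d) : act (t • M) z = t • act M z := by
  simp [act]
lemma act_one {d : ℕ} (z : EE d) : act (1 : Matrix (Fin d) (Fin d) ℝ) z = z := by
  simp [act]

lemma pert_norm {d : ℕ} {C : Matrix (Fin d) (Fin d) ℝ} {t : ℝ} (h0 : 0 ≤ t) (h1 : t ≤ 1) (hC : ‖C‖ ≤ 1/8) (z : EE d) :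
    ‖act (1 + t • C) z‖ ≤ 9/8 * ‖z‖ := by
  rw [act_add, act_one, act_smul]
  have a1 : ‖act C z‖ ≤ 1/8 * ‖z‖ := (norm_act_le _ _).trans (by gcongr)
  have a2 : ‖t • act C z‖ ≤ ‖act C z‖ := by
    rw [norm_smul, Real.norm_of_nonneg h0]; exact mul_le_of_le_one_left (norm_nonneg _) h1
  have := norm_add_le z (t • act C z)
  linarith

lemma pert_unit {d : ℕ} {C : Matrix (Fin d) (Fin d) ℝ} {t : ℝ} (h0 : 0 ≤ t) (h1 : t ≤ 1) (hC : ‖C‖ ≤ 1/8) :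
    IsUnit (1 + t • C).det := by
  rw [isUnit_iff_ne_zero]
  intro h
  obtain ⟨v, hv, hv0⟩ := Matrix.exists_mulVec_eq_zero_iff.2 h
  set z : EE d := WithLp.toLp 2 v with hz
  have e : act (1 + t • C) z = 0 := by
    ext i
    rw [act_apply]
    have := congrFun hv0 i
    simpa [Matrix.mulVec, dotProduct] using this
  rw [act_add, act_one, act_smul] at e
  have a1 : ‖act C z‖ ≤ 1/8 * ‖z‖ := (norm_act_le _ _).trans (by gcongr)
  have a2 : ‖t • act C z‖ ≤ ‖act C z‖ := by
    rw [norm_smul, Real.norm_of_nonneg h0]; exact mul_le_of_le_one_left (norm_nonneg _) h1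
  have a3 : ‖z‖ = ‖t • act C z‖ := by
    conv_lhs => rw [eq_neg_of_add_eq_zero_left e, norm_neg]
  have a4 : ‖z‖ = 0 := by linarith [norm_nonneg z]
  apply hv
  have : z = 0 := norm_eq_zero.1 a4
  have h5 := congrArg WithLp.ofLp this
  simpa [hz] using h5

lemma pert_inv {d : ℕ} {C : Matrix (Fin d) (Fin d) ℝ} {t : ℝ} (h0 : 0 ≤ t) (h1 : t ≤ 1) (hC : ‖C‖ ≤ 1/8) 
    (M : Matrix (Fin d) (Fin d) ℝ) : ‖(1 + t • C)⁻¹ * M‖ ≤ 8/7 * ‖M‖ := by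
  set N := (1 + t • C)⁻¹ * M with hN
  have e : N = M - t • (C * N) := by
    have : (1 + t • C) * N = M := by
      rw [hN, Matrix.mul_nonsing_inv_cancel_left _ _ (pert_unit h0 h1 hC)]
    rw [← this, add_mul, one_mul, smul_mul_assoc]; abel
  have a1 : ‖C * N‖ ≤ 1/8 * ‖N‖ := (Matrix.frobenius_norm_mul C N).trans (by gcongr)
  have a2 : ‖t • (C * N)‖ ≤ ‖C * N‖ := by
    rw [norm_smul, Real.norm_of_nonneg h0]; exact mul_le_of_le_one_left (norm_nonneg _) h1
  have a3 : ‖N‖ ≤ ‖M‖ + ‖t • (C * N)‖ := by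
    calc ‖N‖ = ‖M - t • (C * N)‖ := by rw [← e]
      _ ≤ _ := norm_sub_le _ _
  linarith

lemma pert_diff {d : ℕ} {C C' : Matrix (Fin d) (Fin d) ℝ} {t : ℝ} (h0 : 0 ≤ t) (h1 : t ≤ 1) (hC : ‖C‖ ≤ 1/8) :
    ‖(1 + t • C)⁻¹ * (1 + t • C') - 1‖ ≤ 8/7 * ‖C - C'‖ := by
  have e : (1 + t • C)⁻¹ * (1 + t • C') - 1 = (1 + t • C)⁻¹ * (t • (C' - C)) := by
    have : (1 : Matrix (Fin d) (Fin d) ℝ) = (1 + t • C)⁻¹ * (1 + t • C) := 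
      (Matrix.nonsing_inv_mul _ (pert_unit h0 h1 hC)).symm
    calc _ = (1 + t • C)⁻¹ * (1 + t • C') - (1 + t • C)⁻¹ * (1 + t • C) := by rw [← this]
      _ = _ := by rw [← mul_sub]; congr 1; rw [smul_sub]; abel
  rw [e]
  refine (pert_inv h0 h1 hC _).trans ?_
  rw [norm_smul, Real.norm_of_nonneg h0, norm_sub_rev]
  have := mul_le_of_le_one_left (norm_nonneg (C - C')) h1
  linarith

/-- scalar Cauchy-Schwarz -/
lemma cs_real {α : Type*} [MeasurableSpace α] {μ : Measure α} {f g : α → ℝ}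
    (mf : AEStronglyMeasurable f μ) (mg : AEStronglyMeasurable g μ)
    (hf : Integrable (fun x => f x ^ 2) μ) (hg : Integrable (fun x => g x ^ 2) μ) :
    Integrable (fun x => f x * g x) μ ∧ 
    |∫ x, f x * g x ∂μ| ≤ √(∫ x, f x ^ 2 ∂μ) * √(∫ x, g x ^ 2 ∂μ) := by
  have := cs_inner (d := 1) (μ := μ) (f := fun x => EuclideanSpace.single 0 (f x)) 
    (g := fun x => EuclideanSpace.single 0 (g x))
    (by
      have : (fun x => (EuclideanSpace.single 0 (f x) : EE 1)) = fun x => f x • (EuclideanSpace.single 0 1 : EE 1) := by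
        ext; simp
      rw [this]; exact mf.smul_const _)
    (by
      have : (fun x => (EuclideanSpace.single 0 (g x) : EE 1)) = fun x => g x • (EuclideanSpace.single 0 1 : EE 1) := by
        ext; simp
      rw [this]; exact mg.smul_const _)
    (by simpa using hf) (by simpa using hg)
  simpa [PiLp.inner_apply, mul_comm] using this

lemma w_int (d : ℕ) (hd : 1 ≤ d) : Integrable (fun z : EE d => (‖z‖ * (√d + ‖z‖ ^ 2)) ^ 2) (gam d) ∧ 
    ∫ z : EE d, (‖z‖ * (√d + ‖z‖ ^ 2)) ^ 2 ∂(gam d) = Rd d := by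
  simp_rw [mul_pow]
  exact ⟨(moment_bound hd).1, rfl⟩

lemma arith_pair {ε c c' R L L' I I' : ℝ} (hε0 : 0 ≤ ε) (hε1 : ε ≤ c + c') (hc : c ≤ 1/8) (hc' : c' ≤ 1/8) 
    (hR : 0 ≤ R) (hL : 0 ≤ L) (hL' : 0 ≤ L') (hI : 0 ≤ I) (hI' : 0 ≤ I') (h : I ≤ 9/8 * ε * (R * L))
    (h' : I' ≤ 9/8 * ε * (R * L')) :
    (8/7 * ε + (8/7 * ε) ^ 2 / 2) * (I + I') ≤ 144/49 * (c ^ 2 + c' ^ 2) * R * (L + L') := by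
  have hε2 : ε ^ 2 ≤ 2 * (c ^ 2 + c' ^ 2) := by
    nlinarith [sq_nonneg (c - c')]
  have hk : 8/7 * ε + (8/7 * ε) ^ 2 / 2 ≤ 64/49 * ε := by nlinarith
  calc _ ≤ (64/49 * ε) * (9/8 * ε * (R * L) + 9/8 * ε * (R * L')) := 
        mul_le_mul hk (add_le_add h h') (by positivity) (by positivity)
    _ = 72/49 * ε ^ 2 * R * (L + L') := by ring
    _ ≤ 72/49 * (2 * (c ^ 2 + c' ^ 2)) * R * (L + L') := by gcongr
    _ = _ := by ring

lemma pair_pt {d : ℕ} (hd : 1 ≤ d) {C C' : Matrix (Fin d) (Fin d) ℝ} {t : ℝ} (h0 : 0 ≤ t) (h1 : t ≤ 1) 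
    (hC : ‖C‖ ≤ 1/8) (hC' : ‖C'‖ ≤ 1/8) {g : EE d → EE d} (mg : Measurable g)
    (ig : Integrable (fun z => ‖g (act (1 + t • C) z)‖ ^ 2) (gam d))
    (ig' : Integrable (fun z => ‖g (act (1 + t • C') z)‖ ^ 2) (gam d)) :
    |∫ z, ⟪g (act (1 + t • C) z), act (C - C') (act (1 + t • C) z)⟫ ∂(gam d) - 
     ∫ z, ⟪g (act (1 + t • C') z), act (C - C') (act (1 + t • C') z)⟫ ∂(gam d)| ≤ 
    144/49 * (‖C‖ ^ 2 + ‖C'‖ ^ 2) * √(Rd d) * (√(∫ z, ‖g (act (1 + t • C) z)‖ ^ 2 ∂(gam d)) + √(∫ z, ‖g (act (1 + t • C') z)‖ ^ 2 ∂(gam d))) := by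
  obtain ⟨ε, hε⟩ : ∃ ε, ε = ‖C - C'‖ := ⟨_, rfl⟩
  have hε0 : 0 ≤ ε := hε ▸ norm_nonneg _
  have key : ∀ B : Matrix (Fin d) (Fin d) ℝ, ‖B‖ ≤ 1/8 → Integrable (fun z => ‖g (act (1 + t • B) z)‖ ^ 2) (gam d) →
      Integrable (fun z => ⟪g (act (1 + t • B) z), act (C - C') (act (1 + t • B) z)⟫) (gam d) ∧
      Integrable (fun z => |⟪g (act (1 + t • B) z), act (C - C') (act (1 + t • B) z)⟫| * (√d + ‖z‖ ^ 2)) (gam d) ∧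
      ∫ z, |⟪g (act (1 + t • B) z), act (C - C') (act (1 + t • B) z)⟫| * (√d + ‖z‖ ^ 2) ∂(gam d) ≤ 
        9/8 * ε * (√(Rd d) * √(∫ z, ‖g (act (1 + t • B) z)‖ ^ 2 ∂(gam d))) := by
    intro B hB iB
    have mgB : Measurable (fun z => g (act (1 + t • B) z)) := mg.comp (by fun_prop)
    have i0 : Integrable (fun z => ‖act (C - C') (act (1 + t • B) z)‖ ^ 2) (gam d) := by
      simp_rw [← act_mul]; exact (act_gam _).1
    have cs := cs_real (μ := gam d) (f := fun z => ‖z‖ * (√d + ‖z‖ ^ 2)) (g := fun z => ‖g (act (1 + t • B) z)‖)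
      (by fun_prop) (mgB.norm.aestronglyMeasurable) (w_int d hd).1 iB
    have pt : ∀ z, |⟪g (act (1 + t • B) z), act (C - C') (act (1 + t • B) z)⟫| * (√d + ‖z‖ ^ 2) ≤ 
       9/8 * ε * ((‖z‖ * (√d + ‖z‖ ^ 2)) * ‖g (act (1 + t • B) z)‖) := by
      intro z
      have a1 := abs_real_inner_le_norm (g (act (1 + t • B) z)) (act (C - C') (act (1 + t • B) z))
      have a2 : ‖act (C - C') (act (1 + t • B) z)‖ ≤ ε * (9/8 * ‖z‖) := 
        (norm_act_le _ _).trans (by rw [hε]; gcongr; exact pert_norm h0 h1 hB z)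
      calc _ ≤ (‖g (act (1 + t • B) z)‖ * (ε * (9/8 * ‖z‖))) * (√d + ‖z‖ ^ 2) := by
            gcongr; exact a1.trans (by gcongr)
        _ = _ := by ring
    have mi : Measurable (fun z => ⟪g (act (1 + t • B) z), act (C - C') (act (1 + t • B) z)⟫) := 
      mgB.inner (by fun_prop)
    have iw : Integrable (fun z => |⟪g (act (1 + t • B) z), act (C - C') (act (1 + t • B) z)⟫| * (√d + ‖z‖ ^ 2)) (gam d) := by
      refine (cs.1.const_mul (9/8 * ε)).mono' ?_ (Filter.Eventually.of_forall fun z => ?_)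
      · exact (mi.norm.mul (by fun_prop)).aestronglyMeasurable
      · rw [Real.norm_of_nonneg (by positivity)]; exact pt z
    refine ⟨(cs_inner mgB.aestronglyMeasurable (by fun_prop) iB i0).1, iw, ?_⟩
    refine (integral_mono iw (cs.1.const_mul (9/8 * ε)) pt).trans ?_
    rw [integral_const_mul]
    gcongr
    refine (le_abs_self _).trans (cs.2.trans ?_)
    rw [(w_int d hd).2]
  obtain ⟨k1, k2, k3⟩ := key C hC ig
  obtain ⟨k1', k2', k3'⟩ := key C' hC' ig'
  have pb := pair_bound hd (pert_unit h0 h1 hC) (pert_unit h0 h1 hC') (e := 8/7 * ε) ((pert_diff h0 h1 hC).trans_eq (by rw [hε]))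
    ((pert_diff h0 h1 hC').trans_eq (by rw [norm_sub_rev, hε])) (fun x => ⟪g x, act (C - C') x⟫) k1 k1' k2 k2'
  refine pb.trans (arith_pair hε0 (hε ▸ norm_sub_le C C') hC hC' (Real.sqrt_nonneg _) (Real.sqrt_nonneg _) 
    (Real.sqrt_nonneg _) (integral_nonneg fun z => ?_) (integral_nonneg fun z => ?_) k3 k3')
  · exact mul_nonneg (abs_nonneg _) (by positivity)
  · exact mul_nonneg (abs_nonneg _) (by positivity)

end CG

end

section

open MeasureTheory ProbabilityTheory Matrix
open scoped ENNReal RealInnerProductSpace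
open scoped Matrix.Norms.Frobenius
namespace CG

/-- entrywise measurability -/
def MM {Ω : Type*} [MeasurableSpace Ω] {d : ℕ} (M : Ω → Matrix (Fin d) (Fin d) ℝ) : Prop :=
  ∀ i j, Measurable fun ω => M ω i j

lemma MM.mul {Ω : Type*} [MeasurableSpace Ω] {d : ℕ} {M N : Ω → Matrix (Fin d) (Fin d) ℝ} (hM : MM M) (hN : MM N) :
    MM (fun ω => M ω * N ω) := by
  intro i j
  simp only [Matrix.mul_apply]
  exact Finset.measurable_fun_sum _ fun k _ => (hM i k).mul (hN k j)

lemma MM.const {Ω : Type*} [MeasurableSpace Ω] {d : ℕ} (M : Matrix (Fin d) (Fin d) ℝ) : MM (fun _ : Ω => M) := 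
  fun _ _ => measurable_const

lemma MM.add {Ω : Type*} [MeasurableSpace Ω] {d : ℕ} {M N : Ω → Matrix (Fin d) (Fin d) ℝ} (hM : MM M) (hN : MM N) :
    MM (fun ω => M ω + N ω) := fun i j => (hM i j).add (hN i j)

lemma MM.sub {Ω : Type*} [MeasurableSpace Ω] {d : ℕ} {M N : Ω → Matrix (Fin d) (Fin d) ℝ} (hM : MM M) (hN : MM N) :
    MM (fun ω => M ω - N ω) := fun i j => (hM i j).sub (hN i j)

lemma MM.smul {Ω : Type*} [MeasurableSpace Ω] {d : ℕ} {M : Ω → Matrix (Fin d) (Fin d) ℝ} (t : ℝ) (hM : MM M) :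
    MM (fun ω => t • M ω) := fun i j => (hM i j).const_mul t

lemma MM.norm {Ω : Type*} [MeasurableSpace Ω] {d : ℕ} {M : Ω → Matrix (Fin d) (Fin d) ℝ} (hM : MM M) :
    Measurable fun ω => ‖M ω‖ := by
  have : (fun ω => ‖M ω‖) = fun ω => √(∑ i, ∑ j, M ω i j ^ 2) := by
    ext ω; rw [← fro_sq, Real.sqrt_sq (norm_nonneg _)]
  rw [this]
  exact (Finset.measurable_fun_sum _ fun i _ => Finset.measurable_fun_sum _ fun j _ => (hM i j).pow_const 2).sqrt

lemma MM.act {Ω : Type*} [MeasurableSpace Ω] {d : ℕ} {M : Ω → Matrix (Fin d) (Fin d) ℝ} (hM : MM M) :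
    Measurable fun p : Ω × EE d => act (M p.1) p.2 := by
  have : (fun p : Ω × EE d => CG.act (M p.1) p.2) = fun p => WithLp.toLp 2 (fun i => ∑ j, M p.1 i j * p.2 j) := by
    ext p i; rw [act_apply]
  rw [this]
  refine (WithLp.measurable_toLp 2 _).comp (measurable_pi_lambda _ fun i => ?_)
  exact Finset.measurable_fun_sum _ fun j _ => ((hM i j).comp measurable_fst).mul (by fun_prop)

lemma L2act {Ω : Type*} [MeasurableSpace Ω] (P : Measure Ω) [IsProbabilityMeasure P] {d : ℕ} 
    {M : Ω → Matrix (Fin d) (Fin d) ℝ} (hM : MM M) (hi : Integrable (fun ω => ‖M ω‖ ^ 2) P) : 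
    Integrable (fun p : Ω × EE d => ‖act (M p.1) p.2‖ ^ 2) (P.prod (gam d)) ∧ 
    ∫ p : Ω × EE d, ‖act (M p.1) p.2‖ ^ 2 ∂(P.prod (gam d)) = ∫ ω, ‖M ω‖ ^ 2 ∂P := by
  have h : Integrable (fun p : Ω × EE d => ‖act (M p.1) p.2‖ ^ 2) (P.prod (gam d)) := by
    rw [integrable_prod_iff (hM.act.norm.pow_const 2).aestronglyMeasurable]
    refine ⟨Filter.Eventually.of_forall fun ω => (act_gam (M ω)).1, ?_⟩
    simpa [(act_gam _).2] using hi
  refine ⟨h, ?_⟩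
  rw [integral_prod _ h]
  simp only [(act_gam _).2]

lemma inner_expand {d : ℕ} (M : Matrix (Fin d) (Fin d) ℝ) (a b : EE d) : 
    ⟪a, act M b⟫ = ∑ q : Fin d × Fin d, M q.1 q.2 * (a q.1 * b q.2) := by
  rw [Fintype.sum_prod_type, PiLp.inner_apply]
  refine Finset.sum_congr rfl fun i _ => ?_
  rw [act_apply]
  simp [Finset.sum_mul]
  exact Finset.sum_congr rfl fun j _ => by ring

lemma cov_double {Ω ι : Type*} [Fintype ι] [MeasurableSpace Ω] (P : Measure Ω) [IsProbabilityMeasure P]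
    (X Y : ι → Ω → ℝ) (f h : Ω → ℝ) (B : ℝ) (iX : ∀ q, Integrable (X q) P) (iY : ∀ q, Integrable (Y q) P)
    (iXY : ∀ q, Integrable (fun ω => X q ω * Y q ω) P) (iF : Integrable f P) (iH : Integrable h P)
    (iFH : Integrable (fun ω => f ω * h ω) P)
    (hp : ∀ᵐ ω ∂P, ∀ᵐ ω' ∂P, ∑ q, (X q ω - X q ω') * (Y q ω - Y q ω') ≤ B * ((f ω + f ω') * (h ω + h ω'))) :
    ∑ q, (∫ ω, X q ω * Y q ω ∂P) - ∑ q, (∫ ω, X q ω ∂P) * (∫ ω, Y q ω ∂P) ≤ 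
      B * (∫ ω, f ω * h ω ∂P + (∫ ω, f ω ∂P) * (∫ ω, h ω ∂P)) := by
  have s1 : ∀ᵐ ω ∂P, ∑ q, (X q ω * Y q ω - X q ω * (∫ ω, Y q ω ∂P) - (∫ ω, X q ω ∂P) * Y q ω + ∫ ω, X q ω * Y q ω ∂P) 
      ≤ B * (f ω * h ω + f ω * (∫ ω, h ω ∂P) + (∫ ω, f ω ∂P) * h ω + ∫ ω, f ω * h ω ∂P) := by
    filter_upwards [hp] with ω hω
    have e1 : ∀ q, Integrable (fun ω' => (X q ω - X q ω') * (Y q ω - Y q ω')) P ∧ 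
       ∫ ω', (X q ω - X q ω') * (Y q ω - Y q ω') ∂P = X q ω * Y q ω - X q ω * (∫ ω, Y q ω ∂P) - (∫ ω, X q ω ∂P) * Y q ω + ∫ ω, X q ω * Y q ω ∂P := by
      intro q
      have e : ∀ ω', (X q ω - X q ω') * (Y q ω - Y q ω') = X q ω * Y q ω - X q ω * Y q ω' - X q ω' * Y q ω + X q ω' * Y q ω' := fun ω' => by ring
      simp_rw [e]
      have a0 : Integrable (fun ω' : Ω => X q ω * Y q ω) P := integrable_const _
      have a1 := (iY q).const_mul (X q ω)
      have a2 := (iX q).mul_const (Y q ω)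
      refine ⟨((a0.sub a1).sub a2).add (iXY q), ?_⟩
      rw [integral_add (by fun_prop) (iXY q), integral_sub (by fun_prop) a2, integral_sub a0 a1, integral_const_mul (X q ω) (Y q),
        integral_mul_const (Y q ω) (X q)]
      simp
    have e2 : Integrable (fun ω' => B * ((f ω + f ω') * (h ω + h ω'))) P ∧ 
       ∫ ω', B * ((f ω + f ω') * (h ω + h ω')) ∂P = B * (f ω * h ω + f ω * (∫ ω, h ω ∂P) + (∫ ω, f ω ∂P) * h ω + ∫ ω, f ω * h ω ∂P) := by
      have e : ∀ ω', (f ω + f ω') * (h ω + h ω') = f ω * h ω + f ω * h ω' + f ω' * h ω + f ω' * h ω' := fun ω' => by ring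
      simp_rw [e]
      have a0 : Integrable (fun ω' : Ω => f ω * h ω) P := integrable_const _
      have a1 := iH.const_mul (f ω)
      have a2 := iF.mul_const (h ω)
      refine ⟨(((a0.add a1).add a2).add iFH).const_mul B, ?_⟩
      rw [integral_const_mul, integral_add (by fun_prop) iFH, integral_add (by fun_prop) a2, integral_add a0 a1, integral_const_mul (f ω) h,
        integral_mul_const (h ω) f]
      simp
    have := integral_mono_ae (integrable_finsetSum _ fun q _ => (e1 q).1) e2.1 hω
    rw [integral_finsetSum _ fun q _ => (e1 q).1, e2.2] at this
    simpa only [(e1 _).2] using this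
  have e1 : ∀ q, Integrable (fun ω => X q ω * Y q ω - X q ω * (∫ ω, Y q ω ∂P) - (∫ ω, X q ω ∂P) * Y q ω + ∫ ω, X q ω * Y q ω ∂P) P ∧ 
       ∫ ω, (X q ω * Y q ω - X q ω * (∫ ω, Y q ω ∂P) - (∫ ω, X q ω ∂P) * Y q ω + ∫ ω, X q ω * Y q ω ∂P) ∂P = 2 * (∫ ω, X q ω * Y q ω ∂P - (∫ ω, X q ω ∂P) * (∫ ω, Y q ω ∂P)) := by
    intro q
    have a0 : Integrable (fun _ : Ω => ∫ ω, X q ω * Y q ω ∂P) P := integrable_const _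
    have a1 := (iY q).const_mul (∫ ω, X q ω ∂P)
    have a2 := (iX q).mul_const (∫ ω, Y q ω ∂P)
    refine ⟨(((iXY q).sub a2).sub a1).add a0, ?_⟩
    rw [integral_add (by fun_prop) a0, integral_sub (by fun_prop) a1, integral_sub (iXY q) a2, integral_const_mul,
        integral_mul_const]
    simp; ring
  have e2 : Integrable (fun ω => B * (f ω * h ω + f ω * (∫ ω, h ω ∂P) + (∫ ω, f ω ∂P) * h ω + ∫ ω, f ω * h ω ∂P)) P ∧ 
       ∫ ω, B * (f ω * h ω + f ω * (∫ ω, h ω ∂P) + (∫ ω, f ω ∂P) * h ω + ∫ ω, f ω * h ω ∂P) ∂P = 2 * (B * (∫ ω, f ω * h ω ∂P + (∫ ω, f ω ∂P) * (∫ ω, h ω ∂P))) := by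
    have a0 : Integrable (fun _ : Ω => ∫ ω, f ω * h ω ∂P) P := integrable_const _
    have a1 := iH.const_mul (∫ ω, f ω ∂P)
    have a2 := iF.mul_const (∫ ω, h ω ∂P)
    refine ⟨(((iFH.add a2).add a1).add a0).const_mul B, ?_⟩
    rw [integral_const_mul, integral_add (by fun_prop) a0, integral_add (by fun_prop) a1, integral_add iFH a2, integral_const_mul,
        integral_mul_const]
    simp; ring
  have := integral_mono_ae (integrable_finsetSum _ fun q _ => (e1 q).1) e2.1 s1
  rw [integral_finsetSum _ fun q _ => (e1 q).1, e2.2] at this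
  simp only [(e1 _).2] at this
  rw [← Finset.mul_sum, Finset.sum_sub_distrib] at this
  linarith

end CG

end

section

open MeasureTheory ProbabilityTheory Matrix
open scoped ENNReal RealInnerProductSpace
open scoped Matrix.Norms.Frobenius
namespace CG

lemma abs_coord_le {d : ℕ} (v : EE d) (i : Fin d) : v i ^ 2 ≤ ‖v‖ ^ 2 := by
  rw [EuclideanSpace.norm_sq_eq]
  have := Finset.single_le_sum (f := fun i => ‖v i‖ ^ 2) (fun i _ => sq_nonneg _) (Finset.mem_univ i)
  simpa using this

lemma coord_sq_int {α : Type*} [MeasurableSpace α] {μ : Measure α} {d : ℕ} {f : α → EE d} (mf : Measurable f)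
    (hf : Integrable (fun x => ‖f x‖ ^ 2) μ) (i : Fin d) : Integrable (fun x => f x i ^ 2) μ := by
  refine hf.mono' (by fun_prop) (Filter.Eventually.of_forall fun x => ?_)
  rw [Real.norm_of_nonneg (sq_nonneg _)]; exact abs_coord_le _ _

lemma norm_entry_le {d : ℕ} (M : Matrix (Fin d) (Fin d) ℝ) (i j : Fin d) : |M i j| ≤ ‖M‖ := by
  rw [← Real.sqrt_sq (norm_nonneg M), fro_sq, ← Real.sqrt_sq_eq_abs]
  refine Real.sqrt_le_sqrt ?_
  have h1 := Finset.single_le_sum (f := fun j => M i j ^ 2) (fun j _ => sq_nonneg _) (Finset.mem_univ j)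
  have h2 := Finset.single_le_sum (f := fun i => ∑ j, M i j ^ 2) (fun i _ => Finset.sum_nonneg fun j _ => sq_nonneg _) (Finset.mem_univ i)
  exact h1.trans h2

/-- mean of a random matrix -/
noncomputable def mean {Ω : Type*} [MeasurableSpace Ω] (P : Measure Ω) {d : ℕ} (C : Ω → Matrix (Fin d) (Fin d) ℝ) : 
  Matrix (Fin d) (Fin d) ℝ := Matrix.of fun i j => ∫ ω, C ω i j ∂P

lemma bdd_int {Ω : Type*} [MeasurableSpace Ω] (P : Measure Ω) [IsProbabilityMeasure P] {f : Ω → ℝ} (mf : Measurable f)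
    (c : ℝ) (h : ∀ ω, |f ω| ≤ c) : Integrable f P :=
  Integrable.of_bound mf.aestronglyMeasurable c (Filter.Eventually.of_forall h)

lemma speed {Ω : Type*} [MeasurableSpace Ω] (P : Measure Ω) [IsProbabilityMeasure P] {d : ℕ} (hd : 1 ≤ d)
    {C : Ω → Matrix (Fin d) (Fin d) ℝ} (mC : MM C) (hC : ∀ ω, ‖C ω‖ ≤ 1/8) {t : ℝ} (h0 : 0 ≤ t) (h1 : t ≤ 1)
    {g : EE d → EE d} (mg : Measurable g) 
    (ig : Integrable (fun p : Ω × EE d => ‖g (act (1 + t • C p.1) p.2)‖ ^ 2) (P.prod (gam d))) :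
    ∫ p : Ω × EE d, ⟪g (act (1 + t • C p.1) p.2), act (C p.1) p.2⟫ ∂(P.prod (gam d)) ≤ 
      (9/8 * ‖mean P C‖ + √(∫ ω, ‖C ω‖ ^ 4 ∂P) + 288/49 * √(Rd d) * √(∫ ω, ‖C ω‖ ^ 4 ∂P)) *
        √(∫ p : Ω × EE d, ‖g (act (1 + t • C p.1) p.2)‖ ^ 2 ∂(P.prod (gam d))) := by
  set μ := P.prod (gam d) with hμ
  have mS : MM (fun ω => 1 + t • C ω) := (MM.const 1).add (mC.smul t)
  obtain ⟨V, hV⟩ : ∃ V : Ω × EE d → EE d, V = fun p => act (1 + t • C p.1) p.2 := ⟨_, rfl⟩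
  obtain ⟨G, hG⟩ : ∃ G : Ω × EE d → EE d, G = fun p => g (act (1 + t • C p.1) p.2) := ⟨_, rfl⟩
  have mV : Measurable V := by rw [hV]; exact mS.act
  have mG : Measurable G := by rw [hG]; exact mg.comp mS.act
  have ig' : Integrable (fun p => ‖G p‖ ^ 2) μ := by rw [hG]; exact ig
  have hbS : ∀ ω, ‖1 + t • C ω‖ ≤ √d + 1/8 := by
    intro ω
    refine (norm_add_le _ _).trans ?_
    rw [fro_one, norm_smul, Real.norm_of_nonneg h0]
    have := mul_le_of_le_one_left (norm_nonneg (C ω)) h1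
    linarith [hC ω]
  have iV : Integrable (fun p => ‖V p‖ ^ 2) μ := by
    rw [hV]
    refine (L2act P mS (bdd_int P (mS.norm.pow_const 2) ((√d + 1/8) ^ 2) fun ω => ?_)).1
    rw [abs_of_nonneg (by positivity)]; gcongr; exact hbS ω
  have iGV : ∀ q : Fin d × Fin d, Integrable (fun p => G p q.1 * V p q.2) μ := fun q => 
    (cs_real (by fun_prop) (by fun_prop) (coord_sq_int mG ig' _) (coord_sq_int mV iV _)).1
  obtain ⟨Γ, hΓ⟩ : ∃ Γ : Fin d × Fin d → Ω → ℝ, Γ = fun q ω => ∫ z, G (ω, z) q.1 * V (ω, z) q.2 ∂(gam d) := ⟨_, rfl⟩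
  have iΓ : ∀ q, Integrable (Γ q) P := fun q => by rw [hΓ]; exact (iGV q).integral_prod_left
  have aeΓ : ∀ᵐ ω ∂P, ∀ q : Fin d × Fin d, Integrable (fun z => G (ω, z) q.1 * V (ω, z) q.2) (gam d) := 
    ae_all_iff.2 fun q => (iGV q).prod_right_ae
  have expand : ∀ᵐ ω ∂P, ∀ M : Matrix (Fin d) (Fin d) ℝ, ∫ z, ⟪G (ω, z), act M (V (ω, z))⟫ ∂(gam d) = 
      ∑ q : Fin d × Fin d, M q.1 q.2 * Γ q ω := by
    filter_upwards [aeΓ] with ω hω M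
    simp_rw [inner_expand]
    rw [integral_finsetSum _ fun q _ => (hω q).const_mul _]
    simp_rw [integral_const_mul, hΓ]
  obtain ⟨L, hL⟩ : ∃ L : Ω → ℝ, L = fun ω => ∫ z, ‖G (ω, z)‖ ^ 2 ∂(gam d) := ⟨_, rfl⟩
  have iL : Integrable L P := by rw [hL]; exact ig'.integral_prod_left
  have aeL : ∀ᵐ ω ∂P, Integrable (fun z => ‖G (ω, z)‖ ^ 2) (gam d) := ig'.prod_right_ae
  have eL : ∫ ω, L ω ∂P = ∫ p, ‖G p‖ ^ 2 ∂μ := by rw [hL, hμ, integral_prod _ ig']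
  have L0 : ∀ ω, 0 ≤ L ω := fun ω => by rw [hL]; exact integral_nonneg fun z => sq_nonneg _
  have sqL : ∀ ω, √(L ω) ^ 2 = L ω := fun ω => Real.sq_sqrt (L0 ω)
  have msL : AEStronglyMeasurable (fun ω => √(L ω)) P := 
    Real.continuous_sqrt.comp_aestronglyMeasurable iL.1
  have mc := mC.norm
  have ic2 : Integrable (fun ω => ‖C ω‖ ^ 2) P := bdd_int P (mc.pow_const 2) ((1/8) ^ 2) fun ω => by
    rw [abs_of_nonneg (by positivity)]; gcongr; exact hC ω
  have ic4 : Integrable (fun ω => ‖C ω‖ ^ 4) P := bdd_int P (mc.pow_const 4) ((1/8) ^ 4) fun ω => by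
    rw [abs_of_nonneg (by positivity)]; gcongr; exact hC ω
  have ic4' : Integrable (fun ω => (‖C ω‖ ^ 2) ^ 2) P := by simpa [← pow_mul] using ic4
  have isL2 : Integrable (fun ω => √(L ω) ^ 2) P := by simp_rw [sqL]; exact iL
  have cs1 := cs_real (mc.pow_const 2).aestronglyMeasurable msL ic4' isL2
  have isL : Integrable (fun ω => √(L ω)) P := 
    ((memLp_two_iff_integrable_sq msL).2 isL2).integrable (by norm_num)
  obtain ⟨m4, hm4⟩ : ∃ m4, m4 = √(∫ ω, ‖C ω‖ ^ 4 ∂P) := ⟨_, rfl⟩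
  obtain ⟨N, hN⟩ : ∃ N, N = √(∫ p, ‖G p‖ ^ 2 ∂μ) := ⟨_, rfl⟩
  have em4 : √(∫ ω, (‖C ω‖ ^ 2) ^ 2 ∂P) = m4 := by rw [hm4]; simp_rw [← pow_mul]
  have eN : √(∫ ω, √(L ω) ^ 2 ∂P) = N := by rw [hN]; simp_rw [sqL]; rw [eL]
  have b1 : ∫ ω, ‖C ω‖ ^ 2 * √(L ω) ∂P ≤ m4 * N := by
    rw [← em4, ← eN]; exact (le_abs_self _).trans cs1.2
  have b2 : ∫ ω, ‖C ω‖ ^ 2 ∂P ≤ m4 := by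
    rw [← em4]; exact Real.le_sqrt_of_sq_le (sq_integral_le ic2 ic4')
  have b3 : ∫ ω, √(L ω) ∂P ≤ N := by
    rw [← eN]; exact Real.le_sqrt_of_sq_le (sq_integral_le isL isL2)
  have iX : ∀ q : Fin d × Fin d, Integrable (fun ω => C ω q.1 q.2) P := fun q => 
    bdd_int P (mC _ _) (1/8) fun ω => (norm_entry_le _ _ _).trans (hC ω)
  have iXY : ∀ q : Fin d × Fin d, Integrable (fun ω => C ω q.1 q.2 * Γ q ω) P := fun q => by
    refine (iΓ q).bdd_mul (c := 1/8) (mC _ _).aestronglyMeasurable (Filter.Eventually.of_forall fun ω => ?_)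
    exact (norm_entry_le _ _ _).trans (hC ω)
  have hcov := cov_double P (fun q : Fin d × Fin d => fun ω => C ω q.1 q.2) Γ (fun ω => ‖C ω‖ ^ 2) (fun ω => √(L ω))
    (144/49 * √(Rd d)) iX iΓ iXY ic2 isL cs1.1 (by
      filter_upwards [expand, aeL] with ω e1 a1
      filter_upwards [expand, aeL] with ω' e2 a2
      have e1' := e1 (C ω - C ω')
      have e2' := e2 (C ω - C ω')
      rw [hL]
      simp only [hG, hV] at e1' e2' a1 a2 ⊢
      have pp := pair_pt hd h0 h1 (hC ω) (hC ω') mg a1 a2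
      rw [e1', e2'] at pp
      have pp2 := (le_abs_self _).trans pp
      rw [← Finset.sum_sub_distrib] at pp2
      calc _ = ∑ q : Fin d × Fin d, ((C ω - C ω') q.1 q.2 * Γ q ω - (C ω - C ω') q.1 q.2 * Γ q ω') := 
            Finset.sum_congr rfl fun q _ => by simp only [Matrix.sub_apply]; ring
        _ ≤ _ := pp2
        _ = _ := by ring)
  -- main term
  have c0 : 0 ≤ m4 := by rw [hm4]; positivity
  have N0 : 0 ≤ N := by rw [hN]; positivity
  have hcov' : ∑ q : Fin d × Fin d, (∫ ω, C ω q.1 q.2 * Γ q ω ∂P) - ∑ q : Fin d × Fin d, (∫ ω, C ω q.1 q.2 ∂P) * (∫ ω, Γ q ω ∂P) ≤ 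
      288/49 * √(Rd d) * m4 * N := by
    refine hcov.trans ?_
    have : (∫ ω, ‖C ω‖ ^ 2 ∂P) * (∫ ω, √(L ω) ∂P) ≤ m4 * N := 
      mul_le_mul b2 b3 (integral_nonneg fun ω => Real.sqrt_nonneg _) c0
    calc _ ≤ 144/49 * √(Rd d) * (m4 * N + m4 * N) := by gcongr
      _ = _ := by ring
  -- integrals
  have mCS : MM (fun ω => C ω * (1 + t • C ω)) := mC.mul mS
  have iCV : Integrable (fun p => ⟪G p, act (C p.1) (V p)⟫) μ := by
    have : ∀ p, act (C p.1) (V p) = act (C p.1 * (1 + t • C p.1)) p.2 := fun p => by rw [hV, act_mul]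
    simp_rw [this]
    refine (cs_inner mG.aestronglyMeasurable mCS.act.aestronglyMeasurable ig' 
      (L2act P mCS (bdd_int P (mCS.norm.pow_const 2) ((1/8 * (√d + 1/8)) ^ 2) fun ω => ?_)).1).1
    rw [abs_of_nonneg (by positivity)]
    gcongr
    refine (Matrix.frobenius_norm_mul _ _).trans ?_
    gcongr
    · exact hC ω
    · exact hbS ω
  have I1 : ∫ p, ⟪G p, act (C p.1) (V p)⟫ ∂μ = ∑ q : Fin d × Fin d, (∫ ω, C ω q.1 q.2 * Γ q ω ∂P) := by
    rw [hμ, integral_prod _ iCV, ← integral_finsetSum _ fun q _ => iXY q]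
    refine integral_congr_ae ?_
    filter_upwards [expand] with ω hω using hω _
  have mBS : MM (fun ω => mean P C * (1 + t • C ω)) := (MM.const _).mul mS
  have hBS : ∀ ω, ‖mean P C * (1 + t • C ω)‖ ≤ 9/8 * ‖mean P C‖ := by
    intro ω
    rw [mul_add, mul_one, mul_smul_comm]
    refine (norm_add_le _ _).trans ?_
    rw [norm_smul, Real.norm_of_nonneg h0]
    have a1 := mul_le_of_le_one_left (norm_nonneg (mean P C * C ω)) h1
    have a2 := Matrix.frobenius_norm_mul (mean P C) (C ω)
    have a3 := mul_le_mul_of_nonneg_left (hC ω) (norm_nonneg (mean P C))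
    linarith
  have iBS : Integrable (fun ω => ‖mean P C * (1 + t • C ω)‖ ^ 2) P := 
    bdd_int P (mBS.norm.pow_const 2) ((9/8 * ‖mean P C‖) ^ 2) fun ω => by
      rw [abs_of_nonneg (by positivity)]
      gcongr
      exact hBS ω
  have hBV : ∀ p, act (mean P C) (V p) = act (mean P C * (1 + t • C p.1)) p.2 := fun p => by rw [hV, act_mul]
  have csB := cs_inner (μ := μ) (f := G) (g := fun p => act (mean P C * (1 + t • C p.1)) p.2) mG.aestronglyMeasurable 
    mBS.act.aestronglyMeasurable ig' (L2act P mBS iBS).1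
  have I2 : ∑ q : Fin d × Fin d, (∫ ω, C ω q.1 q.2 ∂P) * (∫ ω, Γ q ω ∂P) = ∫ p, ⟪G p, act (mean P C) (V p)⟫ ∂μ := by
    have := csB.1
    simp_rw [← hBV] at this
    rw [hμ, integral_prod _ this]
    have e : ∀ᵐ ω ∂P, ∫ z, ⟪G (ω, z), act (mean P C) (V (ω, z))⟫ ∂(gam d) = ∑ q : Fin d × Fin d, mean P C q.1 q.2 * Γ q ω := by
      filter_upwards [expand] with ω hω using hω _
    rw [integral_congr_ae e, integral_finsetSum _ fun q _ => (iΓ q).const_mul _]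
    simp_rw [integral_const_mul]
    rfl
  have I2b : ∫ p, ⟪G p, act (mean P C) (V p)⟫ ∂μ ≤ 9/8 * ‖mean P C‖ * N := by
    simp_rw [hBV]
    refine (le_abs_self _).trans (csB.2.trans ?_)
    rw [(L2act P mBS iBS).2, ← hN, mul_comm]
    gcongr
    refine Real.sqrt_le_iff.2 ⟨by positivity, ?_⟩
    refine (integral_mono iBS (integrable_const ((9/8 * ‖mean P C‖) ^ 2)) fun ω => ?_).trans ?_
    · simp only []
      gcongr
      exact hBS ω
    · simp
  -- quadratic term
  have mCC : MM (fun ω => C ω * C ω) := mC.mul mC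
  have iCC : Integrable (fun ω => ‖C ω * C ω‖ ^ 2) P := by
    refine ic4'.mono' (mCC.norm.pow_const 2).aestronglyMeasurable (Filter.Eventually.of_forall fun ω => ?_)
    rw [Real.norm_of_nonneg (by positivity), sq (‖C ω‖)]
    gcongr
    exact Matrix.frobenius_norm_mul _ _
  have csC := cs_inner (μ := μ) (f := G) (g := fun p => act (C p.1 * C p.1) p.2) mG.aestronglyMeasurable 
    mCC.act.aestronglyMeasurable ig' (L2act P mCC iCC).1
  have I3 : |∫ p, ⟪G p, act (C p.1 * C p.1) p.2⟫ ∂μ| ≤ m4 * N := by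
    refine csC.2.trans ?_
    rw [(L2act P mCC iCC).2, ← hN, mul_comm, ← em4]
    refine mul_le_mul_of_nonneg_right (Real.sqrt_le_sqrt (integral_mono iCC ic4' fun ω => ?_)) N0
    simp only []
    rw [sq (‖C ω‖)]
    gcongr
    exact Matrix.frobenius_norm_mul _ _
  have eT : ∀ p : Ω × EE d, ⟪G p, act (C p.1) p.2⟫ = ⟪G p, act (C p.1) (V p)⟫ - t * ⟪G p, act (C p.1 * C p.1) p.2⟫ := by
    intro p
    rw [← real_inner_smul_right, ← inner_sub_right, hV]
    congr 1
    have e1 : act (C p.1) (act (1 + t • C p.1) p.2) = act (C p.1) p.2 + t • act (C p.1 * C p.1) p.2 := by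
      rw [act_add, act_one, act_smul, act_mul, ContinuousLinearMap.map_add, ContinuousLinearMap.map_smul]
    rw [e1]; abel
  have goal : ∫ p, ⟪G p, act (C p.1) p.2⟫ ∂μ ≤ (9/8 * ‖mean P C‖ + m4 + 288/49 * √(Rd d) * m4) * N := by
    simp_rw [eT]
    rw [integral_sub iCV (csC.1.const_mul t), integral_const_mul, I1]
    have h3 := (abs_le.1 I3).1
    have h4 : - (t * ∫ p, ⟪G p, act (C p.1 * C p.1) p.2⟫ ∂μ) ≤ m4 * N := by
      have h5 : |t * ∫ p, ⟪G p, act (C p.1 * C p.1) p.2⟫ ∂μ| ≤ m4 * N := by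
        rw [abs_mul, abs_of_nonneg h0]
        exact (mul_le_of_le_one_left (abs_nonneg _) h1).trans I3
      linarith [(abs_le.1 h5).1]
    rw [I2] at hcov'
    linarith
  rw [hm4, hN, hG] at goal
  exact goal

end CG

end

section

open MeasureTheory ProbabilityTheory Matrix
open scoped ENNReal RealInnerProductSpace
open scoped Matrix.Norms.Frobenius
namespace CG

/-- law of `S z` -/
noncomputable def lawS {Ω : Type*} [MeasurableSpace Ω] (P : Measure Ω) {d : ℕ} (S : Ω → Matrix (Fin d) (Fin d) ℝ) : Measure (EE d) :=
  (P.prod (gam d)).map (fun p => act (S p.1) p.2)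

/-- joint law of `(S z, T z)` -/
noncomputable def law2 {Ω : Type*} [MeasurableSpace Ω] (P : Measure Ω) {d : ℕ} (S T : Ω → Matrix (Fin d) (Fin d) ℝ) : 
    Measure (EE d × EE d) :=
  (P.prod (gam d)).map (fun p => (act (S p.1) p.2, act (T p.1) p.2))

/-- coupling statement -/
def Cpl {d : ℕ} (μ ν : Measure (EE d)) (c : ℝ) : Prop :=
  ∃ π : Measure (EE d × EE d), IsProbabilityMeasure π ∧ π.fst = μ ∧ π.snd = ν ∧ 
      Integrable (fun p => ‖p.1 - p.2‖ ^ 2) π ∧ ∫ p, ‖p.1 - p.2‖ ^ 2 ∂π ≤ c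

section
variable {Ω : Type*} [MeasurableSpace Ω] (P : Measure Ω) [IsProbabilityMeasure P] {d : ℕ} 
  {S T : Ω → Matrix (Fin d) (Fin d) ℝ}

lemma law2_prob (mS : MM S) (mT : MM T) : IsProbabilityMeasure (law2 P S T) :=
  Measure.isProbabilityMeasure_map (mS.act.prodMk mT.act).aemeasurable

lemma law2_fst (mT : MM T) : (law2 P S T).fst = lawS P S := by
  rw [law2, Measure.fst_map_prodMk mT.act]; rfl

lemma law2_snd (mS : MM S) : (law2 P S T).snd = lawS P T := by
  rw [law2, Measure.snd_map_prodMk mS.act]; rfl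

lemma law2_cost (mS : MM S) (mT : MM T) (hi : Integrable (fun ω => ‖S ω - T ω‖ ^ 2) P) :
    Integrable (fun p => ‖p.1 - p.2‖ ^ 2) (law2 P S T) ∧ ∫ p, ‖p.1 - p.2‖ ^ 2 ∂(law2 P S T) = ∫ ω, ‖S ω - T ω‖ ^ 2 ∂P := by
  have := L2act P (mS.sub mT) hi
  simp_rw [act_sub] at this
  rw [law2, integrable_map_measure (by fun_prop) (mS.act.prodMk mT.act).aemeasurable, 
    integral_map (mS.act.prodMk mT.act).aemeasurable (by fun_prop)]
  exact this

lemma law2_g (mS : MM S) (mT : MM T) {g : EE d → EE d} (mg : Measurable g) 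
    (ig : Integrable (fun p : EE d × EE d => ‖g p.1‖ ^ 2) (law2 P S T)) :
    Integrable (fun p : Ω × EE d => ‖g (act (S p.1) p.2)‖ ^ 2) (P.prod (gam d)) ∧
    ∫ p, ‖g p.1‖ ^ 2 ∂(law2 P S T) = ∫ p : Ω × EE d, ‖g (act (S p.1) p.2)‖ ^ 2 ∂(P.prod (gam d)) ∧
    ∫ p, ⟪g p.1, p.2 - p.1⟫ ∂(law2 P S T) = ∫ p : Ω × EE d, ⟪g (act (S p.1) p.2), act (T p.1 - S p.1) p.2⟫ ∂(P.prod (gam d)) := by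
  have m1 : Measurable (fun p : EE d × EE d => g p.1) := mg.comp measurable_fst
  rw [law2, integrable_map_measure (m1.norm.pow_const 2).aestronglyMeasurable (mS.act.prodMk mT.act).aemeasurable] at ig
  refine ⟨ig, ?_, ?_⟩
  · rw [law2, integral_map (mS.act.prodMk mT.act).aemeasurable (m1.norm.pow_const 2).aestronglyMeasurable]
  · rw [law2, integral_map (mS.act.prodMk mT.act).aemeasurable (m1.inner (by fun_prop)).aestronglyMeasurable]
    simp_rw [act_sub]

lemma step {μ : Measure (EE d)} {s a b : ℝ} (hs : 0 ≤ s) (ha : 0 ≤ a) (h : Cpl μ (lawS P S) (s ^ 2)) (mS : MM S) (mT : MM T)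
    (hi : Integrable (fun ω => ‖S ω - T ω‖ ^ 2) P) (hb : ∫ ω, ‖S ω - T ω‖ ^ 2 ∂P ≤ b)
    (hg : ∀ g : EE d → EE d, Measurable g → Integrable (fun p : Ω × EE d => ‖g (act (S p.1) p.2)‖ ^ 2) (P.prod (gam d)) →
      ∫ p : Ω × EE d, ⟪g (act (S p.1) p.2), act (T p.1 - S p.1) p.2⟫ ∂(P.prod (gam d)) ≤ 
        a * √(∫ p : Ω × EE d, ‖g (act (S p.1) p.2)‖ ^ 2 ∂(P.prod (gam d)))) :
    Cpl μ (lawS P T) (s ^ 2 + 2 * s * a + b) := by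
  obtain ⟨π, hπ, p1, p2, p3, p4⟩ := h
  haveI := law2_prob P mS mT
  obtain ⟨π', q1, q2, q3, q4, q5⟩ := glue (π := π) (ρ := law2 P S T) (by rw [p2, law2_fst P mT]) p3 (law2_cost P mS mT hi).1 hs ha p4 
    ((law2_cost P mS mT hi).2.trans_le hb) (fun g mg ig => by
      obtain ⟨r1, r2, r3⟩ := law2_g P mS mT mg ig
      rw [r2, r3]
      exact hg g mg r1)
  exact ⟨π', q1, q2.trans p1, q3.trans (law2_snd P mS), q4, q5⟩

lemma Cpl.mono {μ ν : Measure (EE d)} {c c' : ℝ} (h : Cpl μ ν c) (hc : c ≤ c') : Cpl μ ν c' := by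
  obtain ⟨π, a, b, c, d, e⟩ := h
  exact ⟨π, a, b, c, d, e.trans hc⟩

lemma last_step {μ : Measure (EE d)} {s b : ℝ} (hs : 0 ≤ s) (h : Cpl μ (lawS P S) (s ^ 2)) (mS : MM S) (mT : MM T)
    (hi : Integrable (fun ω => ‖S ω - T ω‖ ^ 2) P) (hb : ∫ ω, ‖S ω - T ω‖ ^ 2 ∂P ≤ b) :
    Cpl μ (lawS P T) ((s + √b) ^ 2) := by
  have b0 : 0 ≤ b := le_trans (integral_nonneg fun ω => by positivity) hb
  refine (step P (a := √b) hs (by positivity) h mS mT hi hb ?_).mono ?_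
  · intro g mg ig
    have hi' : Integrable (fun ω => ‖T ω - S ω‖ ^ 2) P := by simpa [norm_sub_rev] using hi
    have := cs_inner (mg.comp mS.act).aestronglyMeasurable (mT.sub mS).act.aestronglyMeasurable ig (L2act P (mT.sub mS) hi').1
    refine (le_abs_self _).trans (this.2.trans ?_)
    rw [mul_comm, (L2act P (mT.sub mS) hi').2]
    refine mul_le_mul_of_nonneg_right (Real.sqrt_le_sqrt ?_) (by positivity)
    simpa [norm_sub_rev] using hb
  · have := Real.sq_sqrt b0
    nlinarith

lemma base (hS : S = fun _ => 1) : Cpl (gam d) (lawS P S) 0 := by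
  have m1 : MM (fun _ : Ω => (1 : Matrix (Fin d) (Fin d) ℝ)) := MM.const 1
  have h := law2_cost P m1 m1 (by simp)
  refine ⟨law2 P (fun _ => 1) (fun _ => 1), law2_prob P m1 m1, ?_, ?_, h.1, ?_⟩
  · rw [law2_fst P m1, lawS]
    simp only [act_one]
    have : (P.prod (gam d)).snd = gam d := by simp
    exact this
  · rw [law2_snd P m1, hS]
  · rw [h.2]; simp

/-- speed constant -/
noncomputable def alph (P : Measure Ω) (C : Ω → Matrix (Fin d) (Fin d) ℝ) : ℝ :=
  9/8 * ‖mean P C‖ + √(∫ ω, ‖C ω‖ ^ 4 ∂P) + 288/49 * √(Rd d) * √(∫ ω, ‖C ω‖ ^ 4 ∂P)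

lemma chain (hd : 1 ≤ d) {C : Ω → Matrix (Fin d) (Fin d) ℝ} (mC : MM C) (hC : ∀ ω, ‖C ω‖ ≤ 1/8) (n : ℕ) (hn : 1 ≤ n) 
    (k : ℕ) (hk : k ≤ n) : 
    Cpl (gam d) (lawS P (fun ω => 1 + ((k:ℝ) / n) • C ω)) ((alph P C * (k / n) + √k / n) ^ 2) := by
  have α0 : 0 ≤ alph P C := by unfold alph; positivity
  have hn0 : (0:ℝ) < n := by exact_mod_cast hn
  induction k with
  | zero =>
    have h := base P (S := fun ω => 1 + (((0:ℕ):ℝ) / n) • C ω)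
      (by funext ω; rw [Nat.cast_zero, zero_div, zero_smul, add_zero])
    exact h.mono (sq_nonneg _)
  | succ k ih =>
    have ih := ih (by omega)
    have mS : ∀ t : ℝ, MM (fun ω => 1 + t • C ω) := fun t => (MM.const 1).add (mC.smul t)
    have diff : ∀ ω, (1 + ((k + 1 : ℕ) / n : ℝ) • C ω) - (1 + ((k:ℝ) / n) • C ω) = (1 / n : ℝ) • C ω := by
      intro ω
      rw [add_sub_add_left_eq_sub, ← sub_smul]; congr 1; push_cast; ring
    have hnn : ∀ ω, ‖(1 + ((k:ℝ) / n) • C ω) - (1 + ((k + 1 : ℕ) / n : ℝ) • C ω)‖ ≤ 1 / n := by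
      intro ω
      rw [norm_sub_rev, diff, norm_smul, Real.norm_of_nonneg (by positivity)]
      exact mul_le_of_le_one_right (by positivity) ((hC ω).trans (by norm_num))
    have hi : Integrable (fun ω => ‖(1 + ((k:ℝ) / n) • C ω) - (1 + ((k + 1 : ℕ) / n : ℝ) • C ω)‖ ^ 2) P := 
      bdd_int P (((mS _).sub (mS _)).norm.pow_const 2) ((1/n) ^ 2) fun ω => by
        rw [abs_of_nonneg (by positivity)]
        exact pow_le_pow_left₀ (norm_nonneg _) (hnn ω) 2
    refine (step P (s := alph P C * (k / n) + √k / n) (a := alph P C / n) (b := (1 / n) ^ 2) (by positivity) 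
      (by positivity) ih (mS _) (mS _) hi ?_ ?_).mono ?_
    · refine (integral_mono hi (integrable_const ((1/n : ℝ) ^ 2)) fun ω => pow_le_pow_left₀ (norm_nonneg _) (hnn ω) 2).trans ?_
      simp
    · intro g mg ig
      simp_rw [diff, act_smul, real_inner_smul_right]
      rw [integral_const_mul]
      have hkn : (k:ℝ) / n ≤ 1 := by
        rw [div_le_one hn0]; exact_mod_cast (by omega : k ≤ n)
      have := speed P hd mC hC (t := (k:ℝ) / n) (by positivity) hkn mg ig
      calc _ ≤ 1 / n * (alph P C * √(∫ p : Ω × EE d, ‖g (act (1 + ((k:ℝ) / n) • C p.1) p.2)‖ ^ 2 ∂(P.prod (gam d)))) := by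
            refine mul_le_mul_of_nonneg_left this (by positivity)
        _ = _ := by ring
    · push_cast
      have s1 : √(k:ℝ) ^ 2 = k := Real.sq_sqrt (by positivity)
      have s2 : √((k:ℝ) + 1) ^ 2 = k + 1 := Real.sq_sqrt (by positivity)
      have s3 : √(k:ℝ) ≤ √((k:ℝ) + 1) := Real.sqrt_le_sqrt (by linarith)
      have s4 : 0 ≤ √(k:ℝ) := Real.sqrt_nonneg _
      set x := √(k:ℝ)
      set y := √((k:ℝ) + 1)
      set α := alph P C
      have e1 : (α * ((k + 1) / n) + y / n) ^ 2 = ((α * (k + 1) + y) ^ 2) / n ^ 2 := by field_simp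
      have e2 : (α * (k / n) + x / n) ^ 2 + 2 * (α * (k / n) + x / n) * (α / n) + (1 / n) ^ 2 = 
        ((α * k + x) ^ 2 + 2 * (α * k + x) * α + 1) / (n:ℝ) ^ 2 := by field_simp
      rw [e1, e2]
      gcongr
      have : (0:ℝ) ≤ k := by positivity
      nlinarith [mul_nonneg (mul_nonneg α0 (by positivity : (0:ℝ) ≤ k + 1)) (sub_nonneg.2 s3), sq_nonneg α]

lemma coupling (hd : 1 ≤ d) {C C' : Ω → Matrix (Fin d) (Fin d) ℝ} (mC : MM C) (hC : ∀ ω, ‖C ω‖ ≤ 1/8) (mC' : MM C')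
    (hi : Integrable (fun ω => ‖C ω - C' ω‖ ^ 2) P) {ε : ℝ} (hε : 0 < ε) :
    Cpl (gam d) (lawS P (fun ω => 1 + C' ω)) ((alph P C + √(∫ ω, ‖C ω - C' ω‖ ^ 2 ∂P) + ε) ^ 2) := by
  have α0 : 0 ≤ alph P C := by unfold alph; positivity
  obtain ⟨n, hn⟩ := exists_nat_gt ((1 / ε) ^ 2)
  have hn0 : (0:ℝ) < n := lt_of_le_of_lt (by positivity) hn
  have hn1 : 1 ≤ n := by exact_mod_cast hn0
  have h := chain P hd mC hC n hn1 n le_rfl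
  rw [div_self hn0.ne', mul_one] at h
  simp only [one_smul] at h
  have := last_step P (T := fun ω => 1 + C' ω) (by positivity) h ((MM.const 1).add mC) ((MM.const 1).add mC') (by simpa using hi) le_rfl
  refine this.mono ?_
  have e : √(n:ℝ) / n ≤ ε := by
    rw [Real.sqrt_div_self', div_le_iff₀ (by positivity)]
    have : 1 / ε < √(n:ℝ) := Real.lt_sqrt_of_sq_lt hn
    rw [div_lt_iff₀ hε] at this
    linarith
  simp only [add_sub_add_left_eq_sub]
  refine pow_le_pow_left₀ (by positivity) ?_ 2
  linarith

end

end CG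

end

section

open MeasureTheory ProbabilityTheory Matrix
open scoped ENNReal RealInnerProductSpace
open scoped Matrix.Norms.Frobenius
namespace CG

lemma norm_C_le {d : ℕ} {S : Matrix (Fin d) (Fin d) ℝ} (hS : S.PosSemidef) : ‖S - 1‖ ≤ ‖S * S - 1‖ := by
  have hT : Sᵀ = S := by simpa [Matrix.IsHermitian] using hS.1
  refine (sq_le_sq₀ (norm_nonneg _) (norm_nonneg _)).1 ?_
  rw [fro_sq_trace, fro_sq_trace]
  have e : (S * S - 1)ᵀ * (S * S - 1) = (S - 1)ᵀ * (S - 1) + (2:ℝ) • ((S - 1)ᴴ * S * (S - 1)) + (S * (S - 1))ᵀ * (S * (S - 1)) := by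
    simp only [Matrix.transpose_sub, Matrix.transpose_mul, Matrix.transpose_one, hT, Matrix.conjTranspose_eq_transpose_of_trivial,
      two_smul]
    noncomm_ring
  have h1 : 0 ≤ ((S - 1)ᴴ * S * (S - 1)).trace := (hS.conjTranspose_mul_mul_same (S - 1)).trace_nonneg
  have h2 : 0 ≤ ((S * (S - 1))ᵀ * (S * (S - 1))).trace := by rw [← fro_sq_trace]; positivity
  rw [e, Matrix.trace_add, Matrix.trace_add, Matrix.trace_smul, smul_eq_mul]
  linarith

lemma D_eq {d : ℕ} (S : Matrix (Fin d) (Fin d) ℝ) : S * S - 1 - (2:ℝ) • (S - 1) = (S - 1) * (S - 1) := by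
  rw [two_smul]; noncomm_ring

lemma norm_C_le' {d : ℕ} {S : Matrix (Fin d) (Fin d) ℝ} (h : ‖S - 1‖ ≤ 1/8) : ‖S - 1‖ ≤ 8/15 * ‖S * S - 1‖ := by
  have h1 : ‖(2:ℝ) • (S - 1)‖ = 2 * ‖S - 1‖ := by rw [norm_smul]; simp
  have h2 : ‖S * S - 1 - (2:ℝ) • (S - 1)‖ ≤ ‖S - 1‖ * ‖S - 1‖ := by rw [D_eq]; exact norm_mul_le _ _
  have h3 := norm_sub_norm_le ((2:ℝ) • (S - 1)) (S * S - 1)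
  rw [norm_sub_rev ((2:ℝ) • (S - 1)) (S * S - 1), h1] at h3
  nlinarith [norm_nonneg (S - 1)]

lemma sum_mul_le {d : ℕ} (M N : Matrix (Fin d) (Fin d) ℝ) : ∑ i, ∑ j, M i j * N i j ≤ ‖M‖ * ‖N‖ := by
  have := Real.sum_mul_le_sqrt_mul_sqrt (Finset.univ : Finset (Fin d × Fin d)) (fun q => M q.1 q.2) (fun q => N q.1 q.2)
  simp only [Fintype.sum_prod_type] at this
  rwa [← fro_sq, ← fro_sq, Real.sqrt_sq (norm_nonneg _), Real.sqrt_sq (norm_nonneg _)] at this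

section
variable {Ω : Type*} [MeasurableSpace Ω] (P : Measure Ω) [IsProbabilityMeasure P] {d : ℕ} 

lemma entry_int {M : Ω → Matrix (Fin d) (Fin d) ℝ} (mM : MM M) {h : Ω → ℝ} (ih : Integrable h P) (hh : ∀ ω, ‖M ω‖ ≤ h ω)
    (i j : Fin d) : Integrable (fun ω => M ω i j) P := 
  ih.mono' (mM i j).aestronglyMeasurable (Filter.Eventually.of_forall fun ω => (norm_entry_le _ i j).trans (hh ω))

lemma norm_mean_le {M : Ω → Matrix (Fin d) (Fin d) ℝ} (mM : MM M) {h : Ω → ℝ} (ih : Integrable h P) (hh : ∀ ω, ‖M ω‖ ≤ h ω) :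
    ‖mean P M‖ ≤ ∫ ω, h ω ∂P := by
  have ie := entry_int P mM ih hh
  by_contra hc
  push Not at hc
  have h0 : 0 ≤ ∫ ω, h ω ∂P := integral_nonneg fun ω => (norm_nonneg _).trans (hh ω)
  obtain ⟨N, hN⟩ : ∃ N, N = mean P M := ⟨_, rfl⟩
  rw [← hN] at hc
  have hNe : ∀ i j, N i j = ∫ ω, M ω i j ∂P := fun i j => by rw [hN]; rfl
  have iS : Integrable (fun ω => ∑ i, ∑ j, N i j * M ω i j) P :=
    integrable_finsetSum _ fun i _ => integrable_finsetSum _ fun j _ => (ie i j).const_mul _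
  have e : ‖N‖ ^ 2 = ∫ ω, ∑ i, ∑ j, N i j * M ω i j ∂P := by
    have h1 : ∀ i, ∫ ω, ∑ j, N i j * M ω i j ∂P = ∑ j, N i j ^ 2 := fun i => by
      rw [integral_finsetSum _ fun j _ => (ie i j).const_mul (N i j)]
      refine Finset.sum_congr rfl fun j _ => ?_
      rw [integral_const_mul, sq, ← hNe]
    have h2 : ∫ ω, ∑ i, ∑ j, N i j * M ω i j ∂P = ∑ i, ∫ ω, ∑ j, N i j * M ω i j ∂P :=
      integral_finsetSum _ fun i _ => integrable_finsetSum _ fun j _ => (ie i j).const_mul (N i j)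
    rw [h2, fro_sq]
    exact Finset.sum_congr rfl fun i _ => (h1 i).symm
  have : ‖N‖ ^ 2 ≤ ‖N‖ * ∫ ω, h ω ∂P := by
    rw [e, ← integral_const_mul]
    refine integral_mono iS (ih.const_mul _) fun ω => ?_
    exact (sum_mul_le _ _).trans (mul_le_mul_of_nonneg_left (hh ω) (norm_nonneg _))
  nlinarith

lemma pow_int {x : Ω → ℝ} (mx : Measurable x) (h0 : ∀ ω, 0 ≤ x ω) (i8 : Integrable (fun ω => x ω ^ 8) P) (k : ℕ) (hk : k ≤ 8) : 
    Integrable (fun ω => x ω ^ k) P := by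
  refine ((integrable_const (1:ℝ)).add i8).mono' (mx.pow_const k).aestronglyMeasurable (Filter.Eventually.of_forall fun ω => ?_)
  rw [Real.norm_of_nonneg (pow_nonneg (h0 ω) _)]
  show _ ≤ 1 + x ω ^ 8
  rcases le_total (x ω) 1 with h | h
  · have := pow_le_one₀ (n := k) (h0 ω) h
    have := pow_nonneg (h0 ω) 8
    linarith
  · have := pow_le_pow_right₀ h hk
    linarith

lemma moments {x : Ω → ℝ} (mx : Measurable x) (h0 : ∀ ω, 0 ≤ x ω) (i8 : Integrable (fun ω => x ω ^ 8) P) :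
    √(∫ ω, x ω ^ 8 ∂P) = √(√(∫ ω, x ω ^ 8 ∂P)) ^ 2 ∧ ∫ ω, x ω ^ 8 ∂P = √(√(∫ ω, x ω ^ 8 ∂P)) ^ 4 ∧ 
    ∫ ω, x ω ^ 4 ∂P ≤ √(√(∫ ω, x ω ^ 8 ∂P)) ^ 2 ∧ ∫ ω, x ω ^ 2 ∂P ≤ √(√(∫ ω, x ω ^ 8 ∂P)) := by
  have p8 : 0 ≤ ∫ ω, x ω ^ 8 ∂P := integral_nonneg fun ω => pow_nonneg (h0 ω) _
  have e1 := Real.sq_sqrt p8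
  have e2 := Real.sq_sqrt (Real.sqrt_nonneg (∫ ω, x ω ^ 8 ∂P))
  have i4 := pow_int P mx h0 i8 4 (by norm_num)
  have i2 := pow_int P mx h0 i8 2 (by norm_num)
  have a := sq_integral_le i4 (by simpa [← pow_mul] using i8)
  have b := sq_integral_le i2 (by simpa [← pow_mul] using i4)
  simp only [← pow_mul] at a b
  norm_num at a b
  have h4 : ∫ ω, x ω ^ 4 ∂P ≤ √(√(∫ ω, x ω ^ 8 ∂P)) ^ 2 := by
    rw [e2]; exact Real.le_sqrt_of_sq_le a
  refine ⟨e2.symm, ?_, h4, ?_⟩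
  · rw [show √(√(∫ ω, x ω ^ 8 ∂P)) ^ 4 = (√(√(∫ ω, x ω ^ 8 ∂P)) ^ 2) ^ 2 by ring, e2, e1]
  · rw [e2] at h4
    exact Real.le_sqrt_of_sq_le (b.trans h4)

end

lemma arith9 {d : ℕ} (hd : 1 ≤ d) {m mD y s v w R C2 : ℝ} (y0 : 0 ≤ y) (y1 : y ≤ 4/625) (s0 : 0 ≤ s) (hs : s ^ 2 = R) 
    (hR : R ≤ 5/4 * (d:ℝ)^3 + 25/2 * (d:ℝ)^2 + 10 * d) (c0 : 0 ≤ C2) (hC2 : 10 * (d:ℝ)^3 + 147 * (d:ℝ)^2 ≤ C2 ^ 2)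
    (hm : m ≤ 1/2 * mD + 1/2 * (64/225 * y + 8^7 * y^4)) (hv : v ≤ 64/225 * y) (hw : w ≤ 512 * y ^ 2) :
    9/8 * m + v + 288/49 * s * v + w ≤ 9/16 * mD + C2 * y := by
  have d1 : (1:ℝ) ≤ d := by exact_mod_cast hd
  have d2 : (d:ℝ) ≤ d ^ 2 := by nlinarith
  have d3 : (1:ℝ) ≤ d ^ 3 := one_le_pow₀ d1
  have c1 : 12.5 ≤ C2 := by
    refine (sq_le_sq₀ (by norm_num) c0).1 ?_
    norm_num; linarith
  have t1 : 288/49 * (64/225) * s ≤ 0.66 * C2 := by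
    refine (sq_le_sq₀ (by positivity) (by positivity)).1 ?_
    rw [mul_pow, hs, mul_pow]
    norm_num
    linarith
  have y3 : 8^7 * y^3 ≤ 0.55 := by
    have := pow_le_pow_left₀ y0 y1 3
    norm_num at this ⊢; linarith
  have y4 : 8^7 * y^4 ≤ 0.55 * y := by
    calc 8^7 * y^4 = (8^7 * y^3) * y := by ring
      _ ≤ _ := mul_le_mul_of_nonneg_right y3 y0
  have y2 : 512 * y ^ 2 ≤ 3.28 * y := by nlinarith
  have v2 : 288/49 * s * v ≤ 0.66 * C2 * y := by
    calc 288/49 * s * v ≤ 288/49 * s * (64/225 * y) := mul_le_mul_of_nonneg_left hv (by positivity)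
      _ = (288/49 * (64/225) * s) * y := by ring
      _ ≤ _ := mul_le_mul_of_nonneg_right t1 y0
  have c2 : 12.5 * y ≤ C2 * y := mul_le_mul_of_nonneg_right c1 y0
  norm_num at *
  linarith

section
variable {Ω : Type*} [MeasurableSpace Ω] (P : Measure Ω) [IsProbabilityMeasure P] {d : ℕ} 

lemma main9 (hd : 1 ≤ d) {S : Ω → Matrix (Fin d) (Fin d) ℝ} (mS : MM S) (hS : ∀ ω, (S ω).PosSemidef) 
    (i8 : Integrable (fun ω => ‖S ω * S ω - 1‖ ^ 8) P) {C2 : ℝ} (c0 : 0 ≤ C2) (hC2 : 10 * (d:ℝ)^3 + 147 * (d:ℝ)^2 ≤ C2 ^ 2)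
    {ε : ℝ} (hε : 0 < ε) :
    Cpl (gam d) (lawS P S) ((9/16 * ‖mean P (fun ω => S ω * S ω - 1)‖ + C2 * √(√(∫ ω, ‖S ω * S ω - 1‖ ^ 8 ∂P)) + ε) ^ 2) := by
  have m1 : MM (fun _ : Ω => (1 : Matrix (Fin d) (Fin d) ℝ)) := MM.const 1
  have mD : MM (fun ω => S ω * S ω - 1) := (mS.mul mS).sub m1
  have mC : MM (fun ω => S ω - 1) := mS.sub m1
  set x : Ω → ℝ := fun ω => ‖S ω * S ω - 1‖ with hx
  have mx : Measurable x := mD.norm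
  have x0 : ∀ ω, 0 ≤ x ω := fun ω => norm_nonneg _
  obtain ⟨e8, e8', e4, e2⟩ := moments P mx x0 i8
  have i4 := pow_int P mx x0 i8 4 (by norm_num)
  have i2 := pow_int P mx x0 i8 2 (by norm_num)
  have i1 : Integrable x P := by simpa using pow_int P mx x0 i8 1 (by norm_num)
  change Cpl _ _ ((9/16 * ‖mean P (fun ω => S ω * S ω - 1)‖ + C2 * √(√(∫ ω, x ω ^ 8 ∂P)) + ε) ^ 2)
  set y := √(√(∫ ω, x ω ^ 8 ∂P)) with hy
  have y0 : 0 ≤ y := Real.sqrt_nonneg _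
  have d1 : (1:ℝ) ≤ d := by exact_mod_cast hd
  have Cx : ∀ ω, ‖S ω - 1‖ ≤ x ω := fun ω => norm_C_le (hS ω)
  have Csq : ∀ ω, ‖S ω - 1‖ ^ 2 ≤ x ω ^ 2 := fun ω => pow_le_pow_left₀ (norm_nonneg _) (Cx ω) 2
  rcases le_total (4/625) y with hyy | hyy
  · -- trivial coupling
    have iC : Integrable (fun ω => ‖(1 : Matrix (Fin d) (Fin d) ℝ) - S ω‖ ^ 2) P := by
      refine i2.mono' ((m1.sub mS).norm.pow_const 2).aestronglyMeasurable (Filter.Eventually.of_forall fun ω => ?_)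
      rw [Real.norm_of_nonneg (sq_nonneg _), norm_sub_rev]
      exact Csq ω
    have hb : ∫ ω, ‖(1 : Matrix (Fin d) (Fin d) ℝ) - S ω‖ ^ 2 ∂P ≤ y := by
      refine (integral_mono iC i2 fun ω => ?_).trans e2
      simp only [norm_sub_rev]; exact Csq ω
    have h := last_step P (S := fun _ => 1) (s := 0) le_rfl ((base P rfl).mono (by norm_num)) m1 mS iC hb
    refine h.mono (pow_le_pow_left₀ (by positivity) ?_ 2)
    have c1 : 12.5 ≤ C2 := by
      refine (sq_le_sq₀ (by norm_num) c0).1 ?_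
      have d3 : (1:ℝ) ≤ d ^ 3 := one_le_pow₀ d1
      have d2 : (1:ℝ) ≤ d ^ 2 := one_le_pow₀ d1
      norm_num; linarith
    have : √y ≤ C2 * y := by
      refine Real.sqrt_le_iff.2 ⟨by positivity, ?_⟩
      have : 12.5 ^ 2 ≤ C2 ^ 2 := pow_le_pow_left₀ (by norm_num) c1 2
      rw [mul_pow]
      norm_num at this
      nlinarith
    have := norm_nonneg (mean P (fun ω => S ω * S ω - 1))
    linarith
  · -- truncation
    classical
    set Ct : Ω → Matrix (Fin d) (Fin d) ℝ := fun ω => if ‖S ω - 1‖ ≤ 1/8 then S ω - 1 else 0 with hCt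
    have mCt : MM Ct := by
      intro i j
      have : (fun ω => Ct ω i j) = fun ω => if ‖S ω - 1‖ ≤ 1/8 then (S ω - 1) i j else 0 := by
        funext ω; simp only [hCt]; split_ifs <;> rfl
      rw [this]
      exact Measurable.ite (measurableSet_le mC.norm measurable_const) (mC i j) measurable_const
    have hCt8 : ∀ ω, ‖Ct ω‖ ≤ 1/8 := by
      intro ω; simp only [hCt]; split_ifs with h
      · exact h
      · simp
    have hCtx : ∀ ω, ‖Ct ω‖ ≤ 8/15 * x ω := by
      intro ω; simp only [hCt]; split_ifs with h
      · exact norm_C_le' h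
      · have := x0 ω; simp; linarith
    have hdiff : ∀ ω, ‖Ct ω - (S ω - 1)‖ ^ 2 ≤ 8 ^ 6 * x ω ^ 8 := by
      intro ω; simp only [hCt]; split_ifs with h
      · have := x0 ω; rw [sub_self, norm_zero]; have := pow_nonneg this 8; norm_num; exact this
      · push Not at h
        rw [zero_sub, norm_neg]
        have h8 : 1 ≤ 8 * x ω := by linarith [Cx ω]
        calc ‖S ω - 1‖ ^ 2 ≤ x ω ^ 2 * 1 := by rw [mul_one]; exact Csq ω
          _ ≤ x ω ^ 2 * (8 * x ω) ^ 6 := mul_le_mul_of_nonneg_left (one_le_pow₀ h8) (sq_nonneg _)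
          _ = _ := by ring
    have herr : ∀ ω, ‖S ω * S ω - 1 - (2:ℝ) • Ct ω‖ ≤ 64/225 * x ω ^ 2 + 8 ^ 7 * x ω ^ 8 := by
      intro ω; simp only [hCt]; split_ifs with h
      · rw [D_eq]
        have h1 := norm_C_le' h
        have : ‖(S ω - 1) * (S ω - 1)‖ ≤ (8/15 * x ω) ^ 2 := by
          refine (norm_mul_le _ _).trans ?_
          rw [← sq]; exact pow_le_pow_left₀ (norm_nonneg _) h1 2
        have := x0 ω
        have : 0 ≤ 8 ^ 7 * x ω ^ 8 := by positivity
        linarith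
      · push Not at h
        rw [smul_zero, sub_zero]
        have h8 : 1 ≤ 8 * x ω := by linarith [Cx ω]
        have := x0 ω
        have : x ω ≤ 8 ^ 7 * x ω ^ 8 := by
          calc x ω = x ω * 1 := by ring
            _ ≤ x ω * (8 * x ω) ^ 7 := mul_le_mul_of_nonneg_left (one_le_pow₀ h8) (x0 ω)
            _ = _ := by ring
        have : 0 ≤ 64/225 * x ω ^ 2 := by positivity
        change x ω ≤ _
        linarith
    have iX : Integrable (fun ω => 64/225 * x ω ^ 2 + 8 ^ 7 * x ω ^ 8) P := (i2.const_mul _).add (i8.const_mul _)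
    have mErr : MM (fun ω => S ω * S ω - 1 - (2:ℝ) • Ct ω) := mD.sub (mCt.smul 2)
    have hm1 : ‖mean P (fun ω => S ω * S ω - 1 - (2:ℝ) • Ct ω)‖ ≤ 64/225 * y + 8 ^ 7 * y ^ 4 := by
      refine (norm_mean_le P mErr iX herr).trans ?_
      rw [integral_add (i2.const_mul _) (i8.const_mul _), integral_const_mul, integral_const_mul, e8']
      linarith
    have hm2 : mean P Ct = (1/2:ℝ) • mean P (fun ω => S ω * S ω - 1) - (1/2:ℝ) • mean P (fun ω => S ω * S ω - 1 - (2:ℝ) • Ct ω) := by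
      ext i j
      have a1 := entry_int P mD i1 (fun ω => le_rfl) i j
      have a2 : Integrable (fun ω => Ct ω i j) P := entry_int P mCt (integrable_const (1/8)) hCt8 i j
      simp only [mean, Matrix.sub_apply, Matrix.smul_apply, Matrix.of_apply, smul_eq_mul] at a1 ⊢
      rw [integral_sub a1 (a2.const_mul 2), integral_const_mul]
      ring
    have hm : ‖mean P Ct‖ ≤ 1/2 * ‖mean P (fun ω => S ω * S ω - 1)‖ + 1/2 * (64/225 * y + 8^7 * y^4) := by
      rw [hm2]
      refine (norm_sub_le _ _).trans ?_
      rw [norm_smul, norm_smul, Real.norm_of_nonneg (by norm_num)]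
      linarith
    have hv : √(∫ ω, ‖Ct ω‖ ^ 4 ∂P) ≤ 64/225 * y := by
      refine Real.sqrt_le_iff.2 ⟨by positivity, ?_⟩
      have hp : ∀ ω, ‖Ct ω‖ ^ 4 ≤ (8/15) ^ 4 * x ω ^ 4 := fun ω => by
        rw [← mul_pow]; exact pow_le_pow_left₀ (norm_nonneg _) (hCtx ω) 4
      have := integral_mono_of_nonneg (μ := P) (Filter.Eventually.of_forall fun ω => pow_nonneg (norm_nonneg (Ct ω)) 4) 
        (i4.const_mul ((8/15) ^ 4)) (Filter.Eventually.of_forall hp)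
      rw [integral_const_mul] at this
      refine this.trans ?_
      rw [mul_pow]
      norm_num
      linarith
    have iw : Integrable (fun ω => ‖Ct ω - (S ω - 1)‖ ^ 2) P := 
      (i8.const_mul (8 ^ 6)).mono' ((mCt.sub mC).norm.pow_const 2).aestronglyMeasurable (Filter.Eventually.of_forall fun ω => by
        rw [Real.norm_of_nonneg (sq_nonneg _)]; exact hdiff ω)
    have hw : √(∫ ω, ‖Ct ω - (S ω - 1)‖ ^ 2 ∂P) ≤ 512 * y ^ 2 := by
      refine Real.sqrt_le_iff.2 ⟨by positivity, ?_⟩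
      refine (integral_mono iw (i8.const_mul (8 ^ 6)) hdiff).trans ?_
      rw [integral_const_mul, e8']
      apply le_of_eq; ring
    have h := coupling P hd mCt hCt8 mC iw hε
    simp only [add_sub_cancel] at h
    refine h.mono (pow_le_pow_left₀ ?_ ?_ 2)
    · unfold alph; positivity
    have Rn : 0 ≤ Rd d := by unfold Rd; exact integral_nonneg fun z => by positivity
    have := arith9 hd y0 hyy (Real.sqrt_nonneg (Rd d)) (Real.sq_sqrt Rn) (moment_bound hd).2 c0 hC2 hm hv hw
    unfold alph
    linarith

end
end CG

end

section

open MeasureTheory ProbabilityTheory Matrix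
open scoped ENNReal RealInnerProductSpace
open scoped Matrix.Norms.Frobenius
namespace CG

section
variable {d : ℕ}

lemma eucl_eq (x : Fin d → ℝ) : euclNorm x = ‖(WithLp.toLp 2 x : EE d)‖ := by
  rw [EuclideanSpace.norm_eq, euclNorm]; simp

lemma act_toLp (M : Matrix (Fin d) (Fin d) ℝ) (x : Fin d → ℝ) : act M (WithLp.toLp 2 x : EE d) = WithLp.toLp 2 (M.mulVec x) := by
  ext i; rw [act_apply]; rfl

lemma dot_eq (x y : Fin d → ℝ) : x ⬝ᵥ y = ⟪(WithLp.toLp 2 x : EE d), (WithLp.toLp 2 y : EE d)⟫ := by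
  rw [PiLp.inner_apply]; simp [dotProduct, mul_comm]

lemma inner_act (M : Matrix (Fin d) (Fin d) ℝ) (x y : EE d) : ⟪x, act M y⟫ = ⟪act Mᵀ x, y⟫ := by
  rw [inner_expand, real_inner_comm, inner_expand]
  simp only [Fintype.sum_prod_type, Matrix.transpose_apply]
  rw [Finset.sum_comm]
  refine Finset.sum_congr rfl fun i _ => Finset.sum_congr rfl fun j _ => by ring

/-- standing data: a square root of `K`. -/
structure Rt (K R : Matrix (Fin d) (Fin d) ℝ) : Prop where
  pd : K.PosDef
  psd : R.PosSemidef
  sq : R * R = K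

variable {K R : Matrix (Fin d) (Fin d) ℝ} (h : Rt K R)

lemma Rt.symm (h : Rt K R) : Rᵀ = R := by simpa [Matrix.IsHermitian] using h.psd.1

lemma Rt.Ksymm (h : Rt K R) : Kᵀ = K := by simpa [Matrix.IsHermitian] using h.pd.1

lemma Rt.det (h : Rt K R) : R.det ^ 2 = K.det := by rw [← h.sq, Matrix.det_mul, _root_.sq]

lemma Rt.unit (h : Rt K R) : IsUnit R.det := by
  have h1 := h.det
  have h2 := h.pd.det_pos
  rw [isUnit_iff_ne_zero]; rintro h3
  rw [h3] at h1; norm_num at h1; linarith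

lemma Rt.Kunit (h : Rt K R) : IsUnit K.det := h.pd.det_pos.ne'.isUnit

lemma Rt.inv_symm (h : Rt K R) : (R⁻¹)ᵀ = R⁻¹ := by rw [Matrix.transpose_nonsing_inv, h.symm]

lemma Rt.inv_sq (h : Rt K R) : R⁻¹ * R⁻¹ = K⁻¹ := by rw [← Matrix.mul_inv_rev, h.sq]

lemma Rt.norm_sq (h : Rt K R) (x : EE d) : ‖act R x‖ ^ 2 = ⟪x, act K x⟫ := by
  rw [← h.sq, act_mul, inner_act, h.symm, real_inner_self_eq_norm_sq]

lemma lambda_set_eq (K : Matrix (Fin d) (Fin d) ℝ) : {r : ℝ | ∃ x : Fin d → ℝ, euclNorm x = 1 ∧ r = x ⬝ᵥ K.mulVec x} = 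
    {r | ∃ x : EE d, ‖x‖ = 1 ∧ r = ⟪x, act K x⟫} := by
  ext r; constructor
  · rintro ⟨x, h1, h2⟩
    exact ⟨WithLp.toLp 2 x, by rw [← eucl_eq, h1], by rw [h2, dot_eq, act_toLp]⟩
  · rintro ⟨x, h1, h2⟩
    exact ⟨x.ofLp, by rw [eucl_eq]; exact h1, by rw [h2, dot_eq, ← act_toLp]⟩

lemma op_set_eq (K : Matrix (Fin d) (Fin d) ℝ) : {r : ℝ | ∃ x : Fin d → ℝ, euclNorm x = 1 ∧ r = euclNorm (K.mulVec x)} = 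
    {r | ∃ x : EE d, ‖x‖ = 1 ∧ r = ‖act K x‖} := by
  ext r; constructor
  · rintro ⟨x, h1, h2⟩
    exact ⟨WithLp.toLp 2 x, by rw [← eucl_eq, h1], by rw [h2, eucl_eq, act_toLp]⟩
  · rintro ⟨x, h1, h2⟩
    exact ⟨x.ofLp, by rw [eucl_eq]; exact h1, by rw [h2, eucl_eq, ← act_toLp]⟩

lemma Rt.lambda_pos (h : Rt K R) (hd : 1 ≤ d) : 0 < lambdaMin K := by
  rw [lambdaMin, lambda_set_eq]
  have hx : ∀ x : EE d, ‖x‖ = 1 → 1 ≤ ‖R⁻¹‖ * ‖act R x‖ := by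
    intro x hx
    have := norm_act_le R⁻¹ (act R x)
    rwa [← act_mul, Matrix.nonsing_inv_mul _ h.unit, act_one, hx] at this
  let x0 : EE d := EuclideanSpace.single ⟨0, hd⟩ 1
  have n0 : ‖x0‖ = 1 := by simp [x0]
  have hp : 0 < ‖R⁻¹‖ := by
    rcases (norm_nonneg R⁻¹).eq_or_lt with h0 | h0
    · have := hx x0 n0; rw [← h0] at this; linarith
    · exact h0
  refine lt_of_lt_of_le (b := (1 / ‖R⁻¹‖) ^ 2) (by positivity) (le_csInf ⟨_, x0, n0, rfl⟩ ?_)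
  rintro r ⟨x, h1, rfl⟩
  rw [← h.norm_sq]
  refine pow_le_pow_left₀ (by positivity) ?_ 2
  rw [div_le_iff₀ hp, mul_comm]; exact hx x h1

lemma Rt.lambda_le (h : Rt K R) (x : EE d) : lambdaMin K * ‖x‖ ^ 2 ≤ ⟪x, act K x⟫ := by
  rcases eq_or_ne x 0 with rfl | hx
  · simp
  have hn : 0 < ‖x‖ := norm_pos_iff.2 hx
  have hb : BddBelow {r | ∃ x : EE d, ‖x‖ = 1 ∧ r = ⟪x, act K x⟫} := 
    ⟨0, by rintro r ⟨x, _, rfl⟩; rw [← h.norm_sq]; positivity⟩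
  have := csInf_le hb ⟨(‖x‖⁻¹ : ℝ) • x, by rw [norm_smul]; simp [hn.ne'], rfl⟩
  rw [← lambda_set_eq] at this
  change lambdaMin K ≤ _ at this
  rw [map_smul, real_inner_smul_left, real_inner_smul_right, ← mul_assoc, ← _root_.sq, inv_pow, inv_mul_eq_div, le_div_iff₀ (by positivity)] at this
  exact this

lemma op_le (K : Matrix (Fin d) (Fin d) ℝ) (x : EE d) : ‖act K x‖ ≤ opNorm K * ‖x‖ := by
  rcases eq_or_ne x 0 with rfl | hx
  · simp
  have hn : 0 < ‖x‖ := norm_pos_iff.2 hx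
  have hb : BddAbove {r | ∃ x : EE d, ‖x‖ = 1 ∧ r = ‖act K x‖} := 
    ⟨‖K‖, by rintro r ⟨x, h1, rfl⟩; have := norm_act_le K x; rwa [h1, mul_one] at this⟩
  have := le_csSup hb ⟨(‖x‖⁻¹ : ℝ) • x, by rw [norm_smul]; simp [hn.ne'], rfl⟩
  rw [← op_set_eq] at this
  change _ ≤ opNorm K at this
  rw [map_smul, norm_smul, norm_inv, norm_norm, inv_mul_eq_div, div_le_iff₀ hn] at this
  exact this

lemma op_nonneg (K : Matrix (Fin d) (Fin d) ℝ) : 0 ≤ opNorm K := by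
  rw [opNorm, op_set_eq]
  exact Real.sSup_nonneg (by rintro r ⟨x, _, rfl⟩; positivity)

lemma Rt.actR (h : Rt K R) (x : EE d) : ‖act R x‖ ^ 2 ≤ opNorm K * ‖x‖ ^ 2 := by
  rw [h.norm_sq]
  have := op_le K x
  calc _ ≤ ‖x‖ * ‖act K x‖ := real_inner_le_norm _ _
    _ ≤ ‖x‖ * (opNorm K * ‖x‖) := mul_le_mul_of_nonneg_left this (norm_nonneg _)
    _ = _ := by ring

lemma Rt.actKinv (h : Rt K R) (hd : 1 ≤ d) (x : EE d) : ‖act K⁻¹ x‖ ≤ ‖x‖ / lambdaMin K := by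
  have hl := h.lambda_pos hd
  have h1 := h.lambda_le (act K⁻¹ x)
  rw [← act_mul, Matrix.mul_nonsing_inv _ h.Kunit, act_one] at h1
  have h2 := real_inner_le_norm (act K⁻¹ x) x
  rw [le_div_iff₀ hl]
  rcases (norm_nonneg (act K⁻¹ x)).eq_or_lt with h0 | h0
  · rw [← h0]; simp
  · nlinarith

lemma Rt.KinvM (h : Rt K R) (hd : 1 ≤ d) (M : Matrix (Fin d) (Fin d) ℝ) : ‖K⁻¹ * M‖ ≤ ‖M‖ / lambdaMin K := by
  have hl := h.lambda_pos hd
  refine (sq_le_sq₀ (by positivity) (by positivity)).1 ?_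
  rw [div_pow, ← (act_gam (K⁻¹ * M)).2, ← (act_gam M).2, div_eq_mul_inv, mul_comm, ← integral_const_mul]
  refine integral_mono (act_gam _).1 ((act_gam _).1.const_mul _) fun z => ?_
  have := h.actKinv hd (act M z)
  simp only [act_mul]
  calc ‖act K⁻¹ (act M z)‖ ^ 2 ≤ (‖act M z‖ / lambdaMin K) ^ 2 := pow_le_pow_left₀ (norm_nonneg _) this 2
    _ = _ := by rw [div_pow]; ring

lemma norm_tr (M : Matrix (Fin d) (Fin d) ℝ) : ‖Mᵀ‖ = ‖M‖ := by
  rw [← Real.sqrt_sq (norm_nonneg _), ← Real.sqrt_sq (norm_nonneg M), fro_sq, fro_sq, Finset.sum_comm]; rfl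

lemma trace_le (M N : Matrix (Fin d) (Fin d) ℝ) : (M * N).trace ≤ ‖M‖ * ‖N‖ := by
  have := sum_mul_le M Nᵀ
  rw [norm_tr] at this
  simpa [Matrix.trace, Matrix.mul_apply] using this

lemma Rt.conj (h : Rt K R) {M : Matrix (Fin d) (Fin d) ℝ} (hM : Mᵀ = M) : ‖R⁻¹ * M * R⁻¹‖ ≤ ‖K⁻¹ * M‖ := by
  refine (sq_le_sq₀ (by positivity) (by positivity)).1 ?_
  rw [fro_sq_trace]
  have e : ((R⁻¹ * M * R⁻¹)ᵀ * (R⁻¹ * M * R⁻¹)).trace = ((K⁻¹ * M) * (K⁻¹ * M)).trace := by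
    rw [← h.inv_sq]
    simp only [Matrix.transpose_mul, h.inv_symm, hM]
    rw [Matrix.trace_mul_comm (R⁻¹ * (M * R⁻¹)), ← Matrix.mul_assoc, Matrix.trace_mul_comm]
    simp only [Matrix.mul_assoc]
    rw [Matrix.trace_mul_comm]
    simp only [Matrix.mul_assoc]
  rw [e, _root_.sq]; exact trace_le _ _

lemma Rt.conj1 (h : Rt K R) (hd : 1 ≤ d) {M : Matrix (Fin d) (Fin d) ℝ} (hM : Mᵀ = M) : 
    ‖R⁻¹ * M * R⁻¹‖ ≤ ‖M‖ / lambdaMin K := (h.conj hM).trans (h.KinvM hd M)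

lemma Rt.conj2 (h : Rt K R) {M : Matrix (Fin d) (Fin d) ℝ} (hM : Mᵀ = M) : 
    ‖R⁻¹ * M * R⁻¹‖ ≤ ‖K⁻¹‖ * ‖M‖ := (h.conj hM).trans (norm_mul_le _ _)

lemma Rt.dim (h : Rt K R) : (d:ℝ) ≤ ‖K⁻¹‖ * ‖K‖ := by
  have := trace_le K⁻¹ K
  rw [Matrix.nonsing_inv_mul _ h.Kunit] at this
  simpa using this

end
end CG

end

section

open MeasureTheory ProbabilityTheory Matrix
open scoped ENNReal RealInnerProductSpace
open scoped Matrix.Norms.Frobenius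
namespace CG

section
variable {d : ℕ} {K R : Matrix (Fin d) (Fin d) ℝ}

/-- forgetting the Euclidean structure -/
def ofE (x : EE d) : Fin d → ℝ := x.ofLp

lemma ofE_meas : Measurable (ofE (d := d)) := by unfold ofE; fun_prop

lemma dens_eq (h : Rt K R) (x : EE d) : 
    |R.det| * gaussDensity K (ofE (act R x)) = (2 * Real.pi) ^ (-(d:ℝ) / 2) * Real.exp (-(1/2) * ‖x‖ ^ 2) := by
  have e1 : ofE (act R x) ⬝ᵥ K⁻¹.mulVec (ofE (act R x)) = ‖x‖ ^ 2 := by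
    rw [dot_eq, ← act_toLp]
    change ⟪act R x, act K⁻¹ (act R x)⟫ = _
    rw [← h.inv_sq, act_mul, ← act_mul R⁻¹ R, Matrix.nonsing_inv_mul _ h.unit, act_one, inner_act, h.inv_symm, ← act_mul,
      Matrix.nonsing_inv_mul _ h.unit, act_one, real_inner_self_eq_norm_sq]
  have hR : 0 < |R.det| := abs_pos.2 h.unit.ne_zero
  rw [gaussDensity, e1, ← mul_assoc]
  congr 1
  rw [Real.sqrt_mul (by positivity), ← h.det, Real.sqrt_sq_eq_abs, mul_inv, mul_comm, mul_assoc, inv_mul_cancel₀ hR.ne', mul_one,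
    Real.sqrt_eq_rpow, ← Real.rpow_natCast, ← Real.rpow_mul (by positivity), ← Real.rpow_neg (by positivity)]
  congr 1; ring

lemma gaussDensity_meas (K : Matrix (Fin d) (Fin d) ℝ) : Measurable (gaussDensity K) := by
  have : Continuous (fun x : Fin d → ℝ => x ⬝ᵥ K⁻¹.mulVec x) := by
    simp only [dotProduct, Matrix.mulVec]; fun_prop
  unfold gaussDensity
  exact ((Real.continuous_exp.comp (continuous_const.mul this)).const_mul _).measurable

lemma law_G (h : Rt K R) : gaussLaw K = (gam d).map (fun x => ofE (act R x)) := by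
  have mA : Measurable (fun x : EE d => act R x) := (act R).continuous.measurable
  have vp : MeasurePreserving (ofE (d := d)) volume volume := PiLp.volume_preserving_ofLp (Fin d)
  ext s hs
  have hs' : MeasurableSet ((ofE (d := d)) ⁻¹' s) := ofE_meas hs
  have mA' : Measurable (fun x : EE d => ofE (act R x)) := ofE_meas.comp mA
  rw [Measure.map_apply mA' hs, gaussLaw, withDensity_apply _ hs, gam_density, withDensity_apply _ (mA' hs)]
  rw [← vp.setLIntegral_comp_preimage hs (gaussDensity_meas K).ennreal_ofReal]
  set u : Set (EE d) := (fun x => ofE (act R x)) ⁻¹' s with hu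
  have hmu : MeasurableSet u := (ofE_meas.comp mA) hs
  have him : (ofE (d := d)) ⁻¹' s = Set.image (act R) u := by
    have : u = (act R) ⁻¹' (ofE ⁻¹' s) := rfl
    rw [this, Set.image_preimage_eq _ (act_surj h.unit)]
  rw [him, lintegral_image_eq_lintegral_abs_det_fderiv_mul volume hmu (fun x _ => (act R).hasFDerivWithinAt) (act_inj h.unit).injOn]
  refine setLIntegral_congr_fun hmu fun x _ => ?_
  rw [det_act]
  beta_reduce
  rw [← ENNReal.ofReal_mul (abs_nonneg _), dens_eq h]

end

section
variable {Ω : Type*} [mΩ : MeasurableSpace Ω] (P : Measure Ω) [IsProbabilityMeasure P] {d : ℕ} {K R : Matrix (Fin d) (Fin d) ℝ}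

lemma charFun_lawS {S : Ω → Matrix (Fin d) (Fin d) ℝ} (mS : MM S) (t : EE d) :
    charFun ((lawS P S).map (fun x => act R x)) t = ∫ ω, ((Real.exp (-(1/2) * ‖act (S ω)ᵀ (act Rᵀ t)‖ ^ 2) : ℝ) : ℂ) ∂P := by
  have mA : Measurable (fun x : EE d => act R x) := (act R).continuous.measurable
  rw [lawS, Measure.map_map mA mS.act, charFun_apply, integral_map (mA.comp mS.act).aemeasurable (by fun_prop)]
  have mm : Measurable (fun p : Ω × EE d => Complex.exp (((⟪act R (act (S p.1) p.2), t⟫ : ℝ) : ℂ) * Complex.I)) := by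
    have : Measurable (fun p : Ω × EE d => act R (act (S p.1) p.2)) := mA.comp mS.act
    fun_prop
  have ii : Integrable (fun p : Ω × EE d => Complex.exp (((⟪act R (act (S p.1) p.2), t⟫ : ℝ) : ℂ) * Complex.I)) (P.prod (gam d)) :=
    Integrable.of_bound mm.aestronglyMeasurable 1 (Filter.Eventually.of_forall fun p => by rw [Complex.norm_exp_ofReal_mul_I])
  change ∫ p : Ω × EE d, Complex.exp (((⟪act R (act (S p.1) p.2), t⟫ : ℝ) : ℂ) * Complex.I) ∂(P.prod (gam d)) = _
  rw [integral_prod _ ii]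
  refine integral_congr_ae (Filter.Eventually.of_forall fun ω => ?_)
  have h1 : ∀ z : EE d, ⟪act R (act (S ω) z), t⟫ = ⟪z, act (S ω)ᵀ (act Rᵀ t)⟫ := by
    intro z
    rw [inner_act, inner_act, Matrix.transpose_transpose, Matrix.transpose_transpose]
  simp only [h1]
  have := charFun_stdGaussian (act (S ω)ᵀ (act Rᵀ t))
  rw [charFun_apply] at this
  change ∫ z, _ ∂(stdGaussian (EE d)) = _
  rw [this]
  push_cast
  congr 1; ring

lemma law_F (h : Rt K R) {S A : Ω → Matrix (Fin d) (Fin d) ℝ} {F : Ω → Fin d → ℝ} {m : {m : MeasurableSpace Ω // m ≤ mΩ}}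
    (hF : CondGaussian P F m.1 A) (mS : MM S) (hS : ∀ ω, (S ω).PosSemidef) (hA : ∀ ω, S ω * S ω = R⁻¹ * A ω * R⁻¹) :
    P.map F = (lawS P S).map (fun x => ofE (act R x)) := by
  obtain ⟨iF, -, -, -, hc⟩ := hF
  have mA : Measurable (fun x : EE d => act R x) := (act R).continuous.measurable
  have aF : AEMeasurable F P := iF.aestronglyMeasurable.aemeasurable
  have aF' : AEMeasurable (fun ω => (WithLp.toLp 2 (F ω) : EE d)) P := by fun_prop
  have key : P.map (fun ω => (WithLp.toLp 2 (F ω) : EE d)) = (lawS P S).map (fun x => act R x) := by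
    haveI : IsProbabilityMeasure (P.map (fun ω => (WithLp.toLp 2 (F ω) : EE d))) := Measure.isProbabilityMeasure_map aF'
    haveI : IsProbabilityMeasure (lawS P S) := Measure.isProbabilityMeasure_map mS.act.aemeasurable
    haveI : IsProbabilityMeasure ((lawS P S).map (fun x => act R x)) := Measure.isProbabilityMeasure_map mA.aemeasurable
    refine Measure.ext_of_charFun (funext fun t => ?_)
    rw [charFun_lawS P mS, charFun_apply, integral_map aF' (by fun_prop)]
    have := hc t.ofLp
    have q : ∀ ω, t.ofLp ⬝ᵥ A ω *ᵥ t.ofLp = ‖act (S ω)ᵀ (act Rᵀ t)‖ ^ 2 := by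
      intro ω
      have hSt : (S ω)ᵀ = S ω := by simpa [Matrix.IsHermitian] using (hS ω).1
      have e1 : R * (R⁻¹ * A ω * R⁻¹) * R = A ω := by
        rw [Matrix.mul_assoc, Matrix.mul_assoc (R⁻¹ * A ω), Matrix.nonsing_inv_mul _ h.unit, Matrix.mul_one, ← Matrix.mul_assoc,
          Matrix.mul_nonsing_inv _ h.unit, Matrix.one_mul]
      rw [dot_eq, ← act_toLp]
      change ⟪t, act (A ω) t⟫ = _
      rw [← e1, ← hA, ← real_inner_self_eq_norm_sq, hSt, h.symm, inner_act (S ω), hSt, act_mul, act_mul, inner_act R, h.symm, act_mul,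
        inner_act (S ω), hSt]
      rw [inner_act (S ω), hSt]
    have e2 := integral_congr_ae this
    rw [integral_condExp m.2] at e2
    simp only [q] at e2
    rw [← e2]
    refine integral_congr_ae (Filter.Eventually.of_forall fun ω => ?_)
    beta_reduce
    rw [dot_eq, real_inner_comm, mul_comm]
  have e : P.map F = (P.map (fun ω => (WithLp.toLp 2 (F ω) : EE d))).map ofE := by
    rw [AEMeasurable.map_map_of_aemeasurable ofE_meas.aemeasurable aF']; rfl
  rw [e, key, Measure.map_map ofE_meas mA]; rfl

lemma W2_le' {μ ν : Measure (Fin d → ℝ)} (π : Measure ((Fin d → ℝ) × (Fin d → ℝ))) (h0 : IsProbabilityMeasure π)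
    (h1 : π.map Prod.fst = μ) (h2 : π.map Prod.snd = ν) : W2 μ ν ≤ √(∫ p, (∑ i, (p.1 i - p.2 i) ^ 2) ∂π) := by
  unfold W2
  refine csInf_le ⟨0, ?_⟩ ⟨π, h0, h1, h2, rfl⟩
  rintro r ⟨_, _, _, _, rfl⟩
  exact Real.sqrt_nonneg _

end
end CG

end

section

open MeasureTheory ProbabilityTheory Matrix
open scoped ENNReal RealInnerProductSpace
open scoped Matrix.Norms.Frobenius
namespace CG
section
variable {d : ℕ} {K R : Matrix (Fin d) (Fin d) ℝ}
lemma W2_le (h : Rt K R) {μ ν : Measure (EE d)} {c : ℝ} (hc : 0 ≤ c) (hp : Cpl μ ν (c ^ 2)) : 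
    W2 (ν.map (fun x => ofE (act R x))) (μ.map (fun x => ofE (act R x))) ≤ √(opNorm K) * c := by
  obtain ⟨π, hπ, p1, p2, p3, p4⟩ := hp
  obtain ⟨f, hf⟩ : ∃ f : EE d → Fin d → ℝ, f = fun x => ofE (act R x) := ⟨_, rfl⟩
  rw [← hf]
  have mA : Measurable f := hf ▸ ofE_meas.comp (act R).continuous.measurable
  have mT : Measurable (fun p : EE d × EE d => (f p.2, f p.1)) := 
    (mA.comp measurable_snd).prodMk (mA.comp measurable_fst)
  have q1 : (π.map (fun p => (f p.2, f p.1))).map Prod.fst = ν.map f := by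
    rw [Measure.map_map measurable_fst mT, ← p2, Measure.snd, Measure.map_map mA measurable_snd]; rfl
  have q2 : (π.map (fun p => (f p.2, f p.1))).map Prod.snd = μ.map f := by
    rw [Measure.map_map measurable_snd mT, ← p1, Measure.fst, Measure.map_map mA measurable_fst]; rfl
  refine (W2_le' (π.map (fun p => (f p.2, f p.1))) (Measure.isProbabilityMeasure_map mT.aemeasurable) q1 q2).trans ?_
  have : √(opNorm K) * c = √(opNorm K * c ^ 2) := by
    rw [Real.sqrt_mul (op_nonneg K), Real.sqrt_sq hc]
  rw [this]
  refine Real.sqrt_le_sqrt ?_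
  have mq : Measurable (fun p : (Fin d → ℝ) × (Fin d → ℝ) => ∑ i, (p.1 i - p.2 i) ^ 2) := by fun_prop
  rw [integral_map mT.aemeasurable mq.aestronglyMeasurable]
  have e : ∀ p : EE d × EE d, ∑ i, (f p.2 i - f p.1 i) ^ 2 = ‖act R (p.1 - p.2)‖ ^ 2 := by
    intro p
    rw [EuclideanSpace.norm_sq_eq, map_sub]
    refine Finset.sum_congr rfl fun i _ => ?_
    rw [PiLp.sub_apply, Real.norm_eq_abs, sq_abs]
    simp only [hf, ofE]; ring
  simp only [e]
  calc ∫ p : EE d × EE d, ‖act R (p.1 - p.2)‖ ^ 2 ∂π ≤ ∫ p, opNorm K * ‖p.1 - p.2‖ ^ 2 ∂π := 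
        integral_mono_of_nonneg (Filter.Eventually.of_forall fun p => sq_nonneg _) (p3.const_mul _) 
          (Filter.Eventually.of_forall fun p => h.actR (p.1 - p.2))
    _ = opNorm K * ∫ p, ‖p.1 - p.2‖ ^ 2 ∂π := integral_const_mul _ _
    _ ≤ _ := mul_le_mul_of_nonneg_left p4 (op_nonneg K)

end
end CG

end

section

open MeasureTheory ProbabilityTheory Matrix
open scoped ENNReal RealInnerProductSpace
open scoped Matrix.Norms.Frobenius
namespace CG

lemma sqrt_ge {a b : ℝ} (ha : 0 ≤ a) (h : a ^ 2 ≤ b) : a ≤ √b := Real.le_sqrt_of_sq_le h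

lemma Cfac_ge {d : ℕ} (hd : 1 ≤ d) : 12.1 ≤ Cfac d := by
  have d1 : (1:ℝ) ≤ d := by exact_mod_cast hd
  have h1 : 2.449 ≤ √(6:ℝ) := Real.le_sqrt_of_sq_le (by norm_num)
  have h2 : 1.414 ≤ √(2:ℝ) := Real.le_sqrt_of_sq_le (by norm_num)
  have h3 : 1 ≤ √(d:ℝ) := Real.le_sqrt_of_sq_le (by norm_num; exact hd)
  unfold Cfac
  norm_num at h1 h2 ⊢
  linarith

lemma C1_ge {d : ℕ} (hd : 1 ≤ d) : 9/16 ≤ √((√3 / (6 * √2)) * Cfac d) := by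
  refine Real.le_sqrt_of_sq_le ?_
  have h := Cfac_ge hd
  have h2 : √(2:ℝ) ≤ 1.415 := Real.sqrt_le_iff.2 (by norm_num)
  have h2' : 0 < √(2:ℝ) := by positivity
  have h3 : 1.73 ≤ √(3:ℝ) := Real.le_sqrt_of_sq_le (by norm_num)
  have : 0.2 ≤ √3 / (6 * √2) := by
    rw [le_div_iff₀ (by positivity)]
    norm_num at *; linarith
  calc (9/16 : ℝ) ^ 2 ≤ 0.2 * 12.1 := by norm_num
    _ ≤ _ := mul_le_mul this h (by norm_num) (by positivity)

lemma C2_ge {d : ℕ} (hd : 1 ≤ d) {a b l ml : ℝ} (hl : 0 < l) (hml : 0 ≤ ml) (ha : 0 ≤ a) (hb : 0 ≤ b) (hab : (d:ℝ) ≤ a * b) :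
    10 * (d:ℝ)^3 + 147 * (d:ℝ)^2 ≤ l ^ 4 * ( (2 * √2 / (l ^ 4 * √3)) * Cfac d * a ^ 2 * (l ^ 2 + 4 * b ^ 2)
              + (2 * √70 * (d : ℝ) ^ 2 / l ^ 4) * ((1/2) * ml + (√2 + 1) * (d : ℝ) / 4)
              + (3 + √3 / 8 + 5 * √10 + 4 * √30 / 3 + √15 / 3 + 10 * √5 / 3) * (2 * (d : ℝ) ^ 2) / l ^ 4 ) := by
  have d1 : (1:ℝ) ≤ d := by exact_mod_cast hd
  have s3p : 0 < √(3:ℝ) := by positivity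
  have e : l ^ 4 * ( (2 * √2 / (l ^ 4 * √3)) * Cfac d * a ^ 2 * (l ^ 2 + 4 * b ^ 2)
              + (2 * √70 * (d : ℝ) ^ 2 / l ^ 4) * ((1/2) * ml + (√2 + 1) * (d : ℝ) / 4)
              + (3 + √3 / 8 + 5 * √10 + 4 * √30 / 3 + √15 / 3 + 10 * √5 / 3) * (2 * (d : ℝ) ^ 2) / l ^ 4 ) = 
        (2 * √2 / √3) * Cfac d * (a ^ 2 * (l ^ 2 + 4 * b ^ 2))
              + (2 * √70 * (d : ℝ) ^ 2) * ((1/2) * ml + (√2 + 1) * (d : ℝ) / 4)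
              + (3 + √3 / 8 + 5 * √10 + 4 * √30 / 3 + √15 / 3 + 10 * √5 / 3) * (2 * (d : ℝ) ^ 2) := by
    generalize 3 + √3 / 8 + 5 * √10 + 4 * √30 / 3 + √15 / 3 + 10 * √5 / 3 = c
    generalize (1/2) * ml + (√2 + 1) * (d : ℝ) / 4 = c'
    field_simp
  rw [e]
  have hC := Cfac_ge hd
  have h2 : 1.414 ≤ √(2:ℝ) := Real.le_sqrt_of_sq_le (by norm_num)
  have h3 : 1.73 ≤ √(3:ℝ) := Real.le_sqrt_of_sq_le (by norm_num)
  have h3' : √(3:ℝ) ≤ 1.733 := Real.sqrt_le_iff.2 (by norm_num)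
  have h10 : 3.16 ≤ √(10:ℝ) := Real.le_sqrt_of_sq_le (by norm_num)
  have h30 : 5.47 ≤ √(30:ℝ) := Real.le_sqrt_of_sq_le (by norm_num)
  have h15 : 3.87 ≤ √(15:ℝ) := Real.le_sqrt_of_sq_le (by norm_num)
  have h5 : 2.23 ≤ √(5:ℝ) := Real.le_sqrt_of_sq_le (by norm_num)
  have h70 : 8.36 ≤ √(70:ℝ) := Real.le_sqrt_of_sq_le (by norm_num)
  have dd : (0:ℝ) ≤ d ^ 2 := by positivity
  have t1 : 78 * (d:ℝ)^2 ≤ (2 * √2 / √3) * Cfac d * (a ^ 2 * (l ^ 2 + 4 * b ^ 2)) := by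
    have u1 : 1.63 ≤ 2 * √2 / √3 := by rw [le_div_iff₀ s3p]; norm_num at *; linarith
    have u2 : 19.6 ≤ (2 * √2 / √3) * Cfac d := 
      le_trans (by norm_num) (mul_le_mul u1 hC (by norm_num) (by positivity))
    have u3 : 4 * (d:ℝ)^2 ≤ a ^ 2 * (l ^ 2 + 4 * b ^ 2) := by
      have : (d:ℝ) ^ 2 ≤ (a * b) ^ 2 := pow_le_pow_left₀ (by positivity) hab 2
      have : 0 ≤ a ^ 2 * l ^ 2 := by positivity
      nlinarith
    calc 78 * (d:ℝ)^2 ≤ 19.6 * (4 * (d:ℝ)^2) := by norm_num; linarith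
      _ ≤ _ := mul_le_mul u2 u3 (by positivity) (by linarith)
  have t2 : 10 * (d:ℝ)^3 ≤ (2 * √70 * (d : ℝ) ^ 2) * ((1/2) * ml + (√2 + 1) * (d : ℝ) / 4) := by
    have u1 : 16.72 * (d:ℝ)^2 ≤ 2 * √70 * (d : ℝ) ^ 2 := mul_le_mul_of_nonneg_right (by norm_num at *; linarith) dd
    have u2 : 0.6 * (d:ℝ) ≤ (1/2) * ml + (√2 + 1) * (d : ℝ) / 4 := by
      have : 1.414 * (d:ℝ) ≤ √2 * d := mul_le_mul_of_nonneg_right h2 (by positivity)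
      norm_num at *; linarith
    have d3 : (0:ℝ) ≤ d ^ 3 := by positivity
    calc 10 * (d:ℝ)^3 ≤ (16.72 * (d:ℝ)^2) * (0.6 * (d:ℝ)) := by ring_nf; norm_num; linarith
      _ ≤ _ := mul_le_mul u1 u2 (by positivity) (by positivity)
  have t3 : 69 * (d:ℝ)^2 ≤ (3 + √3 / 8 + 5 * √10 + 4 * √30 / 3 + √15 / 3 + 10 * √5 / 3) * (2 * (d : ℝ) ^ 2) := by
    have : 34.5 ≤ 3 + √3 / 8 + 5 * √10 + 4 * √30 / 3 + √15 / 3 + 10 * √5 / 3 := by norm_num at *; linarith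
    calc 69 * (d:ℝ)^2 = 34.5 * (2 * (d : ℝ) ^ 2) := by norm_num; ring
      _ ≤ _ := mul_le_mul_of_nonneg_right this (by positivity)
  linarith

section
variable {Ω : Type*} [mΩ : MeasurableSpace Ω] (P : Measure Ω) [IsProbabilityMeasure P] {d : ℕ} {K R : Matrix (Fin d) (Fin d) ℝ}

lemma sq_meas {sq : Matrix (Fin d) (Fin d) ℝ → Matrix (Fin d) (Fin d) ℝ} (hc : ContinuousOn sq {B | B.PosSemidef})
    {B : Ω → Matrix (Fin d) (Fin d) ℝ} (mB : MM B) (hB : ∀ ω, (B ω).PosSemidef) : MM (fun ω => sq (B ω)) := by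
  intro i j
  let s : Set (Fin d → Fin d → ℝ) := {b | (Matrix.of b).PosSemidef}
  let g : s → ℝ := fun b => sq (Matrix.of b.1) i j
  have hg : Continuous g := by
    have h1 := continuousOn_iff_continuous_domRestrict.1 hc
    exact (continuous_apply j).comp ((continuous_apply i).comp h1)
  have hm : Measurable (fun ω => (⟨fun i j => B ω i j, hB ω⟩ : s)) := 
    Measurable.subtype_mk (measurable_pi_lambda _ fun i => measurable_pi_lambda _ fun j => mB i j)
  exact hg.measurable.comp hm

lemma mean_conj (Q : Matrix (Fin d) (Fin d) ℝ) {M : Ω → Matrix (Fin d) (Fin d) ℝ} (iM : ∀ i j, Integrable (fun ω => M ω i j) P) :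
    mean P (fun ω => Q * M ω * Q) = Q * mean P M * Q := by
  ext i j
  simp only [mean, Matrix.mul_apply, Matrix.of_apply]
  have i1 : ∀ i k, Integrable (fun ω => ∑ l, Q i l * M ω l k) P := fun i k => 
    integrable_finsetSum _ fun l _ => (iM l k).const_mul (Q i l)
  rw [integral_finsetSum _ fun k _ => (i1 i k).mul_const (Q k j)]
  refine Finset.sum_congr rfl fun k _ => ?_
  rw [integral_mul_const, integral_finsetSum _ fun l _ => (iM l k).const_mul (Q i l)]
  simp only [integral_const_mul]

end
end CG

end

section

open MeasureTheory ProbabilityTheory Matrix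
open scoped ENNReal RealInnerProductSpace
open scoped Matrix.Norms.Frobenius
namespace CG

/-- Frobenius norm with the instance fixed. -/
noncomputable def fnorm {d : ℕ} (M : Matrix (Fin d) (Fin d) ℝ) : ℝ := ‖M‖

lemma hsNorm_fnorm {d : ℕ} (M : Matrix (Fin d) (Fin d) ℝ) : hsNorm M = fnorm M := hsNorm_eq M

lemma fnorm_nonneg {d : ℕ} (M : Matrix (Fin d) (Fin d) ℝ) : 0 ≤ fnorm M := norm_nonneg M

lemma sqrt_sqrt_eq {x : ℝ} (hx : 0 ≤ x) : √(√x) = x ^ ((1:ℝ)/4) := by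
  rw [Real.sqrt_eq_rpow, Real.sqrt_eq_rpow, ← Real.rpow_mul hx]; norm_num

lemma le_of_eps {w p q t : ℝ} (hp : 0 ≤ p) (h : ∀ ε, 0 < ε → w ≤ p * (q + ε)) (hq : p * q ≤ t) : w ≤ t := by
  refine le_of_forall_pos_le_add fun δ hδ => ?_
  have h1 := h (δ / (p + 1)) (by positivity)
  have h2 : p * (δ / (p + 1)) ≤ δ := by
    rw [mul_div_assoc', div_le_iff₀ (by positivity)]; nlinarith
  nlinarith

section
variable {d : ℕ} {Ω : Type*} [mΩ : MeasurableSpace Ω] (P : Measure Ω) [IsProbabilityMeasure P]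

lemma final1 (hd : 1 ≤ d) (K : Matrix (Fin d) (Fin d) ℝ) (hK : K.PosDef) (F : Ω → Fin d → ℝ)
    (m : {m : MeasurableSpace Ω // m ≤ mΩ}) (A : Ω → Matrix (Fin d) (Fin d) ℝ)
    (hFA : CondGaussian P F m.1 A) (hA8 : Integrable (fun ω => ‖A ω‖ ^ 8) P)
    {br : ℝ} (hbr : 10 * (d:ℝ)^3 + 147 * (d:ℝ)^2 ≤ lambdaMin K ^ 4 * br) :
    W2 (P.map F) (gaussLaw K) ≤ √(opNorm K) * (9/16 * (‖K⁻¹‖ * ‖mean P A - K‖) 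
      + √br * (∫ ω, ‖A ω - K‖ ^ 8 ∂P) ^ ((1:ℝ)/4)) := by
  obtain ⟨sq, hc, hsq⟩ := exists_sqrt d
  have h : Rt K (sq K) := ⟨hK, (hsq K hK.posSemidef).1, (hsq K hK.posSemidef).2⟩
  obtain ⟨R, hR⟩ : ∃ R, R = sq K := ⟨_, rfl⟩
  rw [← hR] at h
  have lp := h.lambda_pos hd
  have mA : MM A := by
    intro i j
    have h1 : Measurable (fun ω i j => A ω i j) := hFA.2.2.2.1.mono m.2 le_rfl
    exact (measurable_pi_apply j).comp ((measurable_pi_apply i).comp h1)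
  have pA := hFA.2.2.1
  have sA : ∀ ω, (A ω)ᵀ = A ω := fun ω => by
    have := (pA ω).isHermitian.eq; simpa [conjTranspose_eq_transpose_of_trivial] using this
  have pB : ∀ ω, (R⁻¹ * A ω * R⁻¹).PosSemidef := fun ω => by
    have := (pA ω).conjTranspose_mul_mul_same R⁻¹
    rwa [conjTranspose_eq_transpose_of_trivial, h.inv_symm] at this
  have mB : MM (fun ω => R⁻¹ * A ω * R⁻¹) := ((MM.const _).mul mA).mul (MM.const _)
  have mS := sq_meas hc mB pB
  obtain ⟨S, hSd⟩ : ∃ S, S = fun ω => sq (R⁻¹ * A ω * R⁻¹) := ⟨_, rfl⟩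
  rw [← hSd] at mS
  have pS : ∀ ω, (S ω).PosSemidef := fun ω => by rw [hSd]; exact (hsq _ (pB ω)).1
  have eS : ∀ ω, S ω * S ω = R⁻¹ * A ω * R⁻¹ := fun ω => by rw [hSd]; exact (hsq _ (pB ω)).2
  have eK : R⁻¹ * K * R⁻¹ = 1 := by
    rw [← h.sq, ← mul_assoc, Matrix.nonsing_inv_mul _ h.unit, one_mul, Matrix.mul_nonsing_inv _ h.unit]
  have eD : ∀ ω, S ω * S ω - 1 = R⁻¹ * (A ω - K) * R⁻¹ := fun ω => by
    rw [eS, mul_sub, sub_mul, eK]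
  have mAK : MM (fun ω => A ω - K) := mA.sub (MM.const K)
  have mD : MM (fun ω => S ω * S ω - 1) := (mS.mul mS).sub (MM.const 1)
  have iAK : Integrable (fun ω => ‖A ω - K‖ ^ 8) P := by
    refine ((hA8.add (integrable_const (‖K‖^8))).const_mul (2^7)).mono' (mAK.norm.pow_const 8).aestronglyMeasurable 
      (Filter.Eventually.of_forall fun ω => ?_)
    rw [Real.norm_of_nonneg (by positivity)]
    exact (pow_le_pow_left₀ (norm_nonneg _) (norm_sub_le _ _) 8).trans (add_pow_le (norm_nonneg _) (norm_nonneg _) 8)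
  have leD : ∀ ω, ‖S ω * S ω - 1‖ ^ 8 ≤ (lambdaMin K ^ 8)⁻¹ * ‖A ω - K‖ ^ 8 := fun ω => by
    rw [eD]
    refine (pow_le_pow_left₀ (norm_nonneg _) (h.conj1 hd (M := A ω - K) ?_) 8).trans (le_of_eq ?_)
    · rw [transpose_sub, sA, h.Ksymm]
    · rw [div_pow]; field_simp
  have iD : Integrable (fun ω => ‖S ω * S ω - 1‖ ^ 8) P := 
    (iAK.const_mul _).mono' (mD.norm.pow_const 8).aestronglyMeasurable 
      (Filter.Eventually.of_forall fun ω => by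
        rw [Real.norm_of_nonneg (by positivity)]; exact leD ω)
  have i1 : Integrable (fun ω => ‖A ω - K‖) P := by
    simpa using pow_int P mAK.norm (fun ω => norm_nonneg _) iAK 1 (by norm_num)
  have ie := entry_int P mAK i1 (fun ω => le_rfl)
  have iAe : ∀ i j, Integrable (fun ω => A ω i j) P := fun i j => by
    have := (ie i j).add (integrable_const (K i j))
    refine this.congr (Filter.Eventually.of_forall fun ω => ?_)
    simp
  have mmean : mean P (fun ω => A ω - K) = mean P A - K := by
    ext i j
    simp only [mean, Matrix.of_apply, Matrix.sub_apply]
    rw [integral_sub (iAe i j) (integrable_const _)]; simp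
  have nmean : ‖mean P (fun ω => S ω * S ω - 1)‖ ≤ ‖K⁻¹‖ * ‖mean P A - K‖ := by
    have : (fun ω => S ω * S ω - 1) = fun ω => R⁻¹ * (A ω - K) * R⁻¹ := funext eD
    rw [this, mean_conj P R⁻¹ ie, mmean]
    refine h.conj2 ?_
    rw [transpose_sub, h.Ksymm]
    congr 1
    ext i j
    simp only [mean, Matrix.transpose_apply, Matrix.of_apply]
    refine integral_congr_ae (Filter.Eventually.of_forall fun ω => ?_)
    have := congrFun (congrFun (sA ω) i) j
    simpa using this
  have X0 : 0 ≤ ∫ ω, ‖A ω - K‖ ^ 8 ∂P := integral_nonneg fun ω => by positivity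
  have ly : √(√(∫ ω, ‖S ω * S ω - 1‖ ^ 8 ∂P)) ≤ (lambdaMin K ^ 2)⁻¹ * (∫ ω, ‖A ω - K‖ ^ 8 ∂P) ^ ((1:ℝ)/4) := by
    rw [← sqrt_sqrt_eq X0]
    have a : ∫ ω, ‖S ω * S ω - 1‖ ^ 8 ∂P ≤ (lambdaMin K ^ 8)⁻¹ * ∫ ω, ‖A ω - K‖ ^ 8 ∂P := by
      rw [← integral_const_mul]
      exact integral_mono iD (iAK.const_mul _) leD
    refine (Real.sqrt_le_sqrt (Real.sqrt_le_sqrt a)).trans (le_of_eq ?_)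
    rw [Real.sqrt_mul (by positivity), Real.sqrt_mul (by positivity)]
    congr 1
    have e1 : (lambdaMin K ^ 8)⁻¹ = (((lambdaMin K ^ 2)⁻¹)^2)^2 := by
      rw [inv_pow, inv_pow, ← pow_mul, ← pow_mul]
    rw [e1, Real.sqrt_sq (by positivity), Real.sqrt_sq (by positivity)]
  have br0 : 0 ≤ br := by
    by_contra hn
    push Not at hn
    have : lambdaMin K ^ 4 * br < 0 := mul_neg_of_pos_of_neg (by positivity) hn
    have : (0:ℝ) ≤ 10 * (d:ℝ)^3 + 147 * (d:ℝ)^2 := by positivity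
    linarith
  have hC2 : 10 * (d:ℝ)^3 + 147 * (d:ℝ)^2 ≤ (lambdaMin K ^ 2 * √br) ^ 2 := by
    rw [mul_pow, Real.sq_sqrt br0, ← pow_mul]; exact hbr
  rw [law_F P h hFA mS pS eS, law_G h]
  refine le_of_eps (Real.sqrt_nonneg _) (fun ε hε => W2_le h (by positivity) (main9 P hd mS pS iD (by positivity) hC2 hε)) ?_
  refine mul_le_mul_of_nonneg_left (add_le_add (mul_le_mul_of_nonneg_left nmean (by norm_num)) ?_) (Real.sqrt_nonneg _)
  refine (mul_le_mul_of_nonneg_left ly (by positivity)).trans (le_of_eq ?_)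
  field_simp

end
end CG

end

/-- Theorem `th_dis_nuo`, 2-Wasserstein part: explicit `W₂` bound. -/
theorem statement_3
    {d : ℕ} (hd : 1 ≤ d)
    {Ω : Type*} [mΩ : MeasurableSpace Ω] (P : Measure Ω) [IsProbabilityMeasure P]
    (K : Matrix (Fin d) (Fin d) ℝ) (hK : K.PosDef)
    (G F : Ω → Fin d → ℝ) (hG : Measure.map G P = gaussLaw K)
    (𝓕 : {m : MeasurableSpace Ω // m ≤ mΩ})
    (A : Ω → Matrix (Fin d) (Fin d) ℝ)
    (hFA : CondGaussian P F 𝓕.1 A)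
    (hA8 : Integrable (fun ω => hsNorm (A ω) ^ 8) P) :
    W2 (Measure.map F P) (Measure.map G P) ≤
      Real.sqrt (opNorm K) *
        Real.sqrt ((Real.sqrt 3 / (6 * Real.sqrt 2)) * Cfac d) * hsNorm K⁻¹ *
        hsNorm ((Matrix.of fun i j => ∫ ω, A ω i j ∂P) - K)
      + ( Real.sqrt (opNorm K) *
            Real.sqrt
              ( (2 * Real.sqrt 2 / (lambdaMin K ^ 4 * Real.sqrt 3)) * Cfac d *
                  hsNorm K⁻¹ ^ 2 * (lambdaMin K ^ 2 + 4 * hsNorm K ^ 2)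
              + (2 * Real.sqrt 70 * (d : ℝ) ^ 2 / lambdaMin K ^ 4) *
                  ((1/2) * maxLog K + (Real.sqrt 2 + 1) * (d : ℝ) / 4)
              + (3 + Real.sqrt 3 / 8 + 5 * Real.sqrt 10 + 4 * Real.sqrt 30 / 3
                  + Real.sqrt 15 / 3 + 10 * Real.sqrt 5 / 3) *
                    (2 * (d : ℝ) ^ 2) / lambdaMin K ^ 4 )
        + 2 / lambdaMin K ^ 2 ) *
        (∫ ω, hsNorm (A ω - K) ^ 8 ∂P) ^ ((1 : ℝ) / 4) := by
  have hA' : Integrable (fun ω => CG.fnorm (A ω) ^ 8) P := by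
    simpa only [CG.hsNorm_fnorm] using hA8
  obtain ⟨sq, hc, hsq⟩ := CG.exists_sqrt d
  have h : CG.Rt K (sq K) := ⟨hK, (hsq K hK.posSemidef).1, (hsq K hK.posSemidef).2⟩
  have dim : (d:ℝ) ≤ CG.fnorm K⁻¹ * CG.fnorm K := h.dim
  simp only [CG.hsNorm_fnorm]
  have ml : 0 ≤ maxLog K := (abs_nonneg _).trans (le_max_left _ _)
  have hbr := CG.C2_ge hd (h.lambda_pos hd) ml (CG.fnorm_nonneg K⁻¹) (CG.fnorm_nonneg K) dim
  have key := CG.final1 P hd K hK F 𝓕 A hFA hA' hbr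
  rw [hG]
  refine key.trans ?_
  have c1 := CG.C1_ge hd
  have o := Real.sqrt_nonneg (opNorm K)
  have X0 : 0 ≤ (∫ ω, CG.fnorm (A ω - K) ^ 8 ∂P) ^ ((1 : ℝ) / 4) := 
    Real.rpow_nonneg (integral_nonneg fun ω => pow_nonneg (CG.fnorm_nonneg _) _) _
  rw [mul_add, add_mul (Real.sqrt (opNorm K) * _), ← mul_assoc (Real.sqrt (opNorm K)) (√_), mul_assoc (Real.sqrt (opNorm K) * _) (CG.fnorm _)]
  rw [← add_assoc]
  refine le_add_of_le_of_nonneg (add_le_add ?_ le_rfl) (mul_nonneg (by positivity) X0)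
  rw [mul_assoc (Real.sqrt (opNorm K))]
  exact mul_le_mul_of_nonneg_left (mul_le_mul_of_nonneg_right c1 (mul_nonneg (CG.fnorm_nonneg _) (CG.fnorm_nonneg _))) o
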